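/- Let v, w ∈ S_n with v ≤ w in Bruhat order, and let r be such that s_r ∉ supp(w). Then both Bruhat interval polytopes Q_{v, s_r w} and Q_{v, w s_r} are combinatorially equivalent to the prism Q_{v,w} × [0,1]. -/

import Mathlib

/-- `simpleT n i` is the adjacent transposition `sᵢ = (i, i+1)` (one-indexed values),
acting on `{1, …, n}` represented (zero-indexed) by `Fin n`.  It is the identity
permutation when `i` is outside the valid range `1 ≤ i ≤ n - 1`. -/
def simpleT (n : ℕ) (i : ℕ) : Equiv.Perm (Fin n) :=
  if h : 1 ≤ i ∧ i < n then Equiv.swap ⟨i - 1, by omega⟩ ⟨i, h.2⟩ else 1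

/-- The (Coxeter) length `ℓ(w)`: the minimal number of adjacent transpositions whose
product is `w`. -/
noncomputable def permLen (n : ℕ) (w : Equiv.Perm (Fin n)) : ℕ :=
  sInf {l : ℕ | ∃ word : List ℕ, word.length = l ∧ (word.map (simpleT n)).prod = w}

/-- `word` is a reduced decomposition of `w`: its product is `w` and its length is `ℓ(w)`. -/
def IsReducedWord (n : ℕ) (word : List ℕ) (w : Equiv.Perm (Fin n)) : Prop :=
  (word.map (simpleT n)).prod = w ∧ word.length = permLen n w

/-- The support of `w`: the set of letters `i` such that `sᵢ` appears in some reduced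
decomposition of `w`. -/
def permSupp (n : ℕ) (w : Equiv.Perm (Fin n)) : Set ℕ :=
  {i | ∃ word : List ℕ, IsReducedWord n word w ∧ i ∈ word}

/-- Bruhat order: `v ≤ w` iff some reduced decomposition of `v` is a subword of some
reduced decomposition of `w`. -/
def bruhatLE (n : ℕ) (v w : Equiv.Perm (Fin n)) : Prop :=
  ∃ wordv wordw : List ℕ, IsReducedWord n wordv v ∧ IsReducedWord n wordw w ∧
    wordv.Sublist wordw

/-- Strict Bruhat order. -/
def bruhatLT (n : ℕ) (v w : Equiv.Perm (Fin n)) : Prop :=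
  bruhatLE n v w ∧ v ≠ w

/-- An occurrence of the pattern `p ∈ S_k` in `w ∈ S_n`: a strictly increasing sequence
`j` of indices such that the entries of `w` along `j` are in the same relative order
as the entries of `p`. -/
def IsPatternOcc {n k : ℕ} (w : Equiv.Perm (Fin n)) (p : Equiv.Perm (Fin k))
    (j : Fin k → Fin n) : Prop :=
  StrictMono j ∧ ∀ a b : Fin k, w (j a) < w (j b) ↔ p a < p b

/-- `w` contains the pattern `p`. -/
def ContainsPattern {n k : ℕ} (w : Equiv.Perm (Fin n)) (p : Equiv.Perm (Fin k)) : Prop :=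
  ∃ j : Fin k → Fin n, IsPatternOcc w p j

/-- `w` avoids the pattern `p`. -/
def AvoidsPattern {n k : ℕ} (w : Equiv.Perm (Fin n)) (p : Equiv.Perm (Fin k)) : Prop :=
  ¬ ContainsPattern w p

/-- `w` contains the pattern `p` exactly once. -/
def ContainsPatternOnce {n k : ℕ} (w : Equiv.Perm (Fin n)) (p : Equiv.Perm (Fin k)) : Prop :=
  ∃! j : Fin k → Fin n, IsPatternOcc w p j

/-- The number of occurrences of the pattern `p` in `w`. -/
noncomputable def numOcc {n k : ℕ} (w : Equiv.Perm (Fin n)) (p : Equiv.Perm (Fin k)) : ℕ :=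
  Set.ncard {j : Fin k → Fin n | IsPatternOcc w p j}

/-- The pattern `321` (one-line notation `1↦3, 2↦2, 3↦1`), as a permutation of `Fin 3`. -/
def pattern321 : Equiv.Perm (Fin 3) := Equiv.swap 0 2

/-- The pattern `3412` (one-line notation `1↦3, 2↦4, 3↦1, 4↦2`). -/
def pattern3412 : Equiv.Perm (Fin 4) := Equiv.swap 0 2 * Equiv.swap 1 3

/-- The pattern `4231` (one-line notation `1↦4, 2↦2, 3↦3, 4↦1`). -/
def pattern4231 : Equiv.Perm (Fin 4) := Equiv.swap 0 3

/-- The pattern `4321` (one-line notation `1↦4, 2↦3, 3↦2, 4↦1`). -/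
def pattern4321 : Equiv.Perm (Fin 4) := Equiv.swap 0 3 * Equiv.swap 1 2

/-- The point `(u(1), …, u(n)) ∈ ℝⁿ` attached to a permutation `u` (one-indexed values). -/
def permPoint (n : ℕ) (u : Equiv.Perm (Fin n)) : Fin n → ℝ :=
  fun k => ((u k : ℕ) : ℝ) + 1

/-- The Bruhat interval polytope `Q_{v,w}`: the convex hull of the points
`(u(1), …, u(n))` for all `u` with `v ≤ u ≤ w` in Bruhat order. -/
noncomputable def BIP (n : ℕ) (v w : Equiv.Perm (Fin n)) : Set (Fin n → ℝ) :=
  convexHull ℝ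
    {x | ∃ u : Equiv.Perm (Fin n), bruhatLE n v u ∧ bruhatLE n u w ∧ x = permPoint n u}

/-- A face of a polytope `P`: a convex extreme subset of `P`. -/
def IsFaceOf {E : Type*} [AddCommGroup E] [Module ℝ E] (P F : Set E) : Prop :=
  IsExtreme ℝ P F ∧ Convex ℝ F

/-- Combinatorial equivalence of two polytopes: an inclusion-preserving (in both
directions) bijection between their face lattices. -/
def CombEquiv {E F : Type*} [AddCommGroup E] [Module ℝ E] [AddCommGroup F] [Module ℝ F]
    (P : Set E) (Q : Set F) : Prop :=
  ∃ e : {A : Set E // IsFaceOf P A} ≃ {B : Set F // IsFaceOf Q B},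
    ∀ A B : {A : Set E // IsFaceOf P A}, A.1 ⊆ B.1 ↔ (e A).1 ⊆ (e B).1

/-- The transposition `(i, j)` (one-indexed values, `1 ≤ i < j ≤ n`), acting on
`{1, …, n}` represented by `Fin n`; identity for invalid input. -/
def transpPerm (n i j : ℕ) : Equiv.Perm (Fin n) :=
  if h : 1 ≤ i ∧ i < j ∧ j ≤ n then Equiv.swap ⟨i - 1, by omega⟩ ⟨j - 1, by omega⟩ else 1

/-- `T̄(u,[v,w])`: the set of transpositions `(i,j)`, `i < j`, with
`u < u·(i,j) ≤ w` and `ℓ(u·(i,j)) = ℓ(u) + 1`. -/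
def upperT (n : ℕ) (u v w : Equiv.Perm (Fin n)) : Set (ℕ × ℕ) :=
  {p | 1 ≤ p.1 ∧ p.1 < p.2 ∧ p.2 ≤ n ∧
    bruhatLT n u (u * transpPerm n p.1 p.2) ∧ bruhatLE n (u * transpPerm n p.1 p.2) w ∧
    permLen n (u * transpPerm n p.1 p.2) = permLen n u + 1}

/-- `T̲(u,[v,w])`: the set of transpositions `(i,j)`, `i < j`, with
`v ≤ u·(i,j) < u` and `ℓ(u·(i,j)) = ℓ(u) - 1`. -/
def lowerT (n : ℕ) (u v w : Equiv.Perm (Fin n)) : Set (ℕ × ℕ) :=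
  {p | 1 ≤ p.1 ∧ p.1 < p.2 ∧ p.2 ≤ n ∧
    bruhatLE n v (u * transpPerm n p.1 p.2) ∧ bruhatLT n (u * transpPerm n p.1 p.2) u ∧
    permLen n (u * transpPerm n p.1 p.2) + 1 = permLen n u}

/-- The permutohedron `Perm₂ ⊂ ℝ³`, a hexagon. -/
noncomputable def Perm2Hex : Set (Fin 3 → ℝ) :=
  convexHull ℝ {x | ∃ σ : Equiv.Perm (Fin 3), x = permPoint 3 σ}

/-- The action of `s_r` on one-indexed letters: swaps `r` and `r + 1`. -/
def srNat (r x : ℕ) : ℕ := if x = r then r + 1 else if x = r + 1 then r else x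


section part1
open Finset

def rk (x : Equiv.Perm ℕ) (k m : ℕ) : ℕ := ∑ j ∈ range k, if m ≤ x j then 1 else 0

def PN (n : ℕ) (x : Equiv.Perm ℕ) : Prop := ∀ j, n ≤ j → x j = j

def bl (x y : Equiv.Perm ℕ) : Prop := ∀ k m, rk x k m ≤ rk y k m

abbrev sw (p : ℕ) : Equiv.Perm ℕ := Equiv.swap p (p + 1)

lemma rk_succ (x : Equiv.Perm ℕ) (k m : ℕ) :
    rk x (k + 1) m = rk x k m + if m ≤ x k then 1 else 0 := by
  unfold rk; rw [sum_range_succ]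

lemma rk_zero (x : Equiv.Perm ℕ) (m : ℕ) : rk x 0 m = 0 := by simp [rk]

lemma bl_refl (x) : bl x x := fun _ _ => le_rfl
lemma bl_trans {x y z} (h : bl x y) (h' : bl y z) : bl x z := fun k m => (h k m).trans (h' k m)

lemma rk_swap (x : Equiv.Perm ℕ) (l q : ℕ) (hlq : l < q) (h m : ℕ) :
    rk (x * Equiv.swap l q) h m + (if l < h ∧ h ≤ q then (if m ≤ x l then 1 else 0) else 0)
    = rk x h m + (if l < h ∧ h ≤ q then (if m ≤ x q then 1 else 0) else 0) := by
  induction h with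
  | zero => simp [rk_zero]
  | succ h ih =>
    rw [rk_succ, rk_succ, Equiv.Perm.mul_apply]
    rcases lt_trichotomy h l with h1 | h1 | h1
    · rw [Equiv.swap_apply_of_ne_of_ne (by omega) (by omega)]
      simp only [show ¬ (l < h ∧ h ≤ q) by omega, show ¬ (l < h+1 ∧ h+1 ≤ q) by omega, if_false] at *
      omega
    · subst h1
      rw [Equiv.swap_apply_left]
      simp only [show ¬ (h < h ∧ h ≤ q) by omega, show (h < h+1 ∧ h+1 ≤ q) by omega, if_false] at *
      simp only [and_self, if_true]
      omega
    · rcases lt_trichotomy h q with h2 | h2 | h2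
      · rw [Equiv.swap_apply_of_ne_of_ne (by omega) (by omega)]
        simp only [show (l < h ∧ h ≤ q) by omega, show (l < h+1 ∧ h+1 ≤ q) by omega] at *
        simp only [and_self, if_true] at *
        omega
      · subst h2
        rw [Equiv.swap_apply_right]
        simp only [show (l < h ∧ h ≤ h) by omega, show ¬ (l < h+1 ∧ h+1 ≤ h) by omega, if_false] at *
        simp only [and_self, if_true] at *
        omega
      · rw [Equiv.swap_apply_of_ne_of_ne (by omega) (by omega)]
        simp only [show ¬ (l < h ∧ h ≤ q) by omega, show ¬ (l < h+1 ∧ h+1 ≤ q) by omega, if_false] at *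
        omega

lemma rk_sw_ne (x : Equiv.Perm ℕ) (p k m : ℕ) (h : k ≠ p + 1) : rk (x * sw p) k m = rk x k m := by
  have := rk_swap x p (p+1) (by omega) k m
  simp only [show ¬ (p < k ∧ k ≤ p + 1) by omega, if_false] at this
  simpa using this

lemma rk_sw_eq (x : Equiv.Perm ℕ) (p m : ℕ) :
    rk (x * sw p) (p+1) m = rk x p m + if m ≤ x (p+1) then 1 else 0 := by
  rw [rk_succ, rk_sw_ne _ _ _ _ (by omega)]; simp

/-- local data at level p+1 -/
lemma bl_sw_sw {v w : Equiv.Perm ℕ} {p : ℕ} (h : bl v w) (hw : w p < w (p+1)) :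
    bl (v * sw p) (w * sw p) := by
  intro k m
  by_cases hk : k = p + 1
  · subst hk
    rw [rk_sw_eq, rk_sw_eq]
    have h0 := h p m
    have h2 := h (p+2) m
    rw [rk_succ, rk_succ, rk_succ, rk_succ] at h2
    split_ifs at * <;> omega
  · rw [rk_sw_ne _ _ _ _ hk, rk_sw_ne _ _ _ _ hk]; exact h k m

lemma bl_sw {w : Equiv.Perm ℕ} {p : ℕ} (hw : w p < w (p+1)) : bl w (w * sw p) := by
  intro k m
  by_cases hk : k = p + 1
  · subst hk
    rw [rk_sw_eq, rk_succ]
    split_ifs at * <;> omega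
  · rw [rk_sw_ne _ _ _ _ hk]

/-- v ≤ w s, v s > v, w s > w ⇒ v ≤ w -/
lemma bl_down {v w : Equiv.Perm ℕ} {p : ℕ} (h : bl v (w * sw p)) (hv : v p < v (p+1)) :
    bl v w := by
  intro k m
  by_cases hk : k = p + 1
  · subst hk
    have h0 := h p m
    have h1 := h (p+1) m
    have h2 := h (p+2) m
    rw [rk_sw_ne _ _ _ _ (by omega)] at h0 h2
    rw [rk_sw_eq] at h1
    rw [rk_succ, rk_succ, rk_succ, rk_succ] at h2
    rw [rk_succ] at *
    rw [rk_succ]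
    split_ifs at * <;> omega
  · have := h k m
    rwa [rk_sw_ne _ _ _ _ hk] at this

lemma mul_sw_sw (x : Equiv.Perm ℕ) (p : ℕ) : x * sw p * sw p = x := by
  rw [mul_assoc, Equiv.swap_mul_self, mul_one]

lemma sw_app_l (x : Equiv.Perm ℕ) (p : ℕ) : (x * sw p) p = x (p+1) := by simp
lemma sw_app_r (x : Equiv.Perm ℕ) (p : ℕ) : (x * sw p) (p+1) = x p := by simp

lemma app_ne (x : Equiv.Perm ℕ) (p : ℕ) : x p ≠ x (p+1) := by
  intro h; have := x.injective h; omega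

/-- v s ≤ w from v ≤ w, w s < w, v s > v -/
lemma bl_up {v w : Equiv.Perm ℕ} {p : ℕ} (h : bl v w) (hw : w (p+1) < w p)
     : bl (v * sw p) w := by
  intro k m
  by_cases hk : k = p + 1
  · subst hk
    have h0 := h p m
    have h1 := h (p+1) m
    have h2 := h (p+2) m
    rw [rk_sw_eq]
    rw [rk_succ, rk_succ, rk_succ, rk_succ] at h2
    rw [rk_succ] at *
    rw [rk_succ] at h1
    split_ifs at * <;> omega
  · rw [rk_sw_ne _ _ _ _ hk]; exact h k m

/-- The interval [v, w s] = J ∪ J s. -/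
lemma interval_A {v w x : Equiv.Perm ℕ} {p : ℕ} (hv : v p < v (p+1)) (hw : w p < w (p+1)) :
    (bl v x ∧ bl x (w * sw p)) ↔
      (bl v x ∧ bl x w) ∨ (bl v (x * sw p) ∧ bl (x * sw p) w) := by
  constructor
  · rintro ⟨h1, h2⟩
    rcases lt_or_gt_of_ne (app_ne x p) with hx | hx
    · exact Or.inl ⟨h1, bl_down h2 hx⟩
    · right
      have hx' : (x * sw p) p < (x * sw p) (p+1) := by rw [sw_app_l, sw_app_r]; exact hx
      refine ⟨bl_down (by rw [mul_sw_sw]; exact h1) hv, ?_⟩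
      refine bl_down (p := p) ?_ hx'
      refine bl_trans (bl_sw hx') ?_
      rwa [mul_sw_sw]
  · rintro (⟨h1, h2⟩ | ⟨h1, h2⟩)
    · exact ⟨h1, bl_trans h2 (bl_sw hw)⟩
    · have h3 := bl_sw_sw h2 hw
      rw [mul_sw_sw] at h3
      refine ⟨?_, h3⟩
      rcases lt_or_gt_of_ne (app_ne x p) with hx | hx
      · exact bl_down h1 hv
      · refine bl_trans h1 ?_
        have hx' : (x * sw p) p < (x * sw p) (p+1) := by rw [sw_app_l, sw_app_r]; exact hx
        have := bl_sw hx'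
        rwa [mul_sw_sw] at this

lemma PN_sw {n p : ℕ} {x : Equiv.Perm ℕ} (hx : PN n x) (hp : p + 1 < n) : PN n (x * sw p) := by
  intro j hj
  rw [Equiv.Perm.mul_apply, Equiv.swap_apply_of_ne_of_ne (by omega) (by omega), hx j hj]

lemma PN_lt {n : ℕ} {x : Equiv.Perm ℕ} (hx : PN n x) {j : ℕ} (hj : j < n) : x j < n := by
  by_contra h
  push Not at h
  have := x.injective (hx (x j) h)
  omega

lemma rk_one (k m : ℕ) (h : k ≤ m) : rk 1 k m = 0 := by
  unfold rk
  apply sum_eq_zero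
  intro j hj
  rw [mem_range] at hj
  apply if_neg
  change ¬ m ≤ j
  omega

lemma rk_eq_zero {x : Equiv.Perm ℕ} {k m : ℕ} : rk x k m = 0 ↔ ∀ j < k, x j < m := by
  unfold rk
  rw [sum_eq_zero_iff]
  simp

lemma bl_one {v : Equiv.Perm ℕ} (h : bl v 1) : v = 1 := by
  have h1 : ∀ k, ∀ j < k, v j < k := by
    intro k
    rw [← rk_eq_zero]
    have := h k k
    rw [rk_one k k le_rfl] at this
    omega
  ext j
  have : ∀ j, v j ≤ j := fun j => Nat.lt_succ_iff.mp (h1 (j+1) j (by omega))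
  simp only [Equiv.Perm.coe_one, id]
  induction j using Nat.strong_induction_on with
  | _ j ih =>
    rcases (this j).lt_or_eq with hj | hj
    · have := ih _ hj
      have := v.injective this
      omega
    · exact hj

end part1

section part2
open Finset

lemma rk_step_m (y : Equiv.Perm ℕ) (k m : ℕ) :
    rk y k m = rk y k (m+1) + if y.symm m < k then 1 else 0 := by
  induction k with
  | zero => simp [rk_zero]
  | succ k ih =>
    rw [rk_succ, rk_succ, ih]
    have h1 : y.symm m = k ↔ y k = m := by
      rw [Equiv.symm_apply_eq]; exact eq_comm
    by_cases h : y k = m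
    · have := h1.2 h
      simp [this, h]
    · have h2 : y.symm m ≠ k := fun h' => h (h1.1 h')
      split_ifs <;> omega

lemma rk_inv (x : Equiv.Perm ℕ) (k m : ℕ) : rk x⁻¹ k m + m = k + rk x m k := by
  induction m with
  | zero => simp [rk]
  | succ m ih =>
    rw [rk_step_m] at ih
    rw [rk_succ]
    have : (x⁻¹).symm m = x m := rfl
    rw [this] at ih
    split_ifs at * <;> omega

lemma bl_inv {x y : Equiv.Perm ℕ} (h : bl x y) : bl x⁻¹ y⁻¹ := by
  intro k m
  have h1 := rk_inv x k m
  have h2 := rk_inv y k m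
  have := h m k
  omega

def ilen (n : ℕ) (x : Equiv.Perm ℕ) : ℕ := ∑ j ∈ range n, rk x j (x j)

lemma sum_two {n p : ℕ} (hp : p + 1 < n) (f : ℕ → ℕ) :
    ∑ j ∈ range n, f j = (∑ j ∈ ((range n).erase p).erase (p+1), f j) + f p + f (p+1) := by
  rw [← Finset.sum_erase_add (range n) f (mem_range.2 (show p < n by omega)),
    ← Finset.sum_erase_add ((range n).erase p) f
      (mem_erase.2 ⟨(by omega : p + 1 ≠ p), mem_range.2 hp⟩)]
  ring

lemma ilen_sw {n p : ℕ} (hp : p + 1 < n) (x : Equiv.Perm ℕ) (h : x p < x (p+1)) :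
    ilen n (x * sw p) = ilen n x + 1 := by
  unfold ilen
  rw [sum_two hp, sum_two hp]
  have : ∑ j ∈ ((range n).erase p).erase (p+1), rk (x * sw p) j ((x * sw p) j) =
      ∑ j ∈ ((range n).erase p).erase (p+1), rk x j (x j) := by
    apply sum_congr rfl
    intro j hj
    rw [mem_erase, mem_erase] at hj
    rw [rk_sw_ne _ _ _ _ hj.1, Equiv.Perm.mul_apply,
      Equiv.swap_apply_of_ne_of_ne hj.2.1 hj.1]
  rw [this, sw_app_l, sw_app_r, rk_sw_eq, rk_sw_ne _ _ _ _ (by omega), rk_succ]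
  split_ifs <;> omega

lemma ilen_sw' {n p : ℕ} (hp : p + 1 < n) (x : Equiv.Perm ℕ) (h : x (p+1) < x p) :
    ilen n (x * sw p) + 1 = ilen n x := by
  have := ilen_sw hp (x * sw p) (by rw [sw_app_l, sw_app_r]; exact h)
  rw [mul_sw_sw] at this
  exact this.symm

lemma eq_one_of_asc {n : ℕ} {x : Equiv.Perm ℕ} (hx : PN n x)
    (h : ∀ p, p + 1 < n → x p < x (p+1)) : x = 1 := by
  have h1 : StrictMono x := by
    apply strictMono_nat_of_lt_succ
    intro p
    by_cases hp : p + 1 < n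
    · exact h p hp
    · rw [hx (p+1) (by omega)]
      by_cases hp' : p < n
      · have := PN_lt hx hp'; omega
      · rw [hx p (by omega)]; omega
  have h2 : StrictMono x.symm := by
    intro a b hab
    by_contra hc
    push Not at hc
    have := h1.monotone hc
    simp at this; omega
  ext j
  have a := h1.id_le j
  have b := h1.monotone (h2.id_le j)
  simp at a b ⊢; omega

lemma exists_desc {n : ℕ} {x : Equiv.Perm ℕ} (hx : PN n x) (h : x ≠ 1) :
    ∃ p, p + 1 < n ∧ x (p+1) < x p := by
  by_contra hc
  push Not at hc
  exact h (eq_one_of_asc hx fun p hp => lt_of_le_of_ne (hc p hp) (app_ne x p))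

lemma ilen_one (n : ℕ) : ilen n 1 = 0 := by
  unfold ilen
  apply sum_eq_zero
  intro j _
  exact rk_one _ _ le_rfl

def TT (n i : ℕ) : Equiv.Perm ℕ := if 1 ≤ i ∧ i < n then sw (i-1) else 1

def Red (n : ℕ) (l : List ℕ) (x : Equiv.Perm ℕ) : Prop :=
  (l.map (TT n)).prod = x ∧ l.length = ilen n x

lemma ilen_word (n : ℕ) (l : List ℕ) : ilen n (l.map (TT n)).prod ≤ l.length := by
  induction l using List.reverseRecOn with
  | nil => simp [ilen_one]
  | append_singleton l i ih =>
    rw [List.map_append, List.prod_append, List.length_append]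
    simp only [List.map_cons, List.map_nil, List.prod_cons, List.prod_nil, mul_one,
      List.length_cons, List.length_nil]
    unfold TT at *
    split_ifs with h
    · set y := (List.map (TT n) l).prod
      rcases lt_or_gt_of_ne (app_ne (l.map (TT n)).prod (i-1)) with h1 | h1
      · have := ilen_sw (n := n) (by omega) _ h1
        unfold TT at this
        omega
      · have := ilen_sw' (n := n) (by omega) _ h1
        unfold TT at this
        omega
    · rw [mul_one]; omega

lemma Red_append {n : ℕ} {l : List ℕ} {i : ℕ} {x : Equiv.Perm ℕ} (h : Red n (l ++ [i]) x) :
    ∃ p, i = p + 1 ∧ p + 1 < n ∧ Red n l (x * sw p) ∧ x (p+1) < x p := by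
  obtain ⟨h1, h2⟩ := h
  rw [List.map_append, List.prod_append] at h1
  simp only [List.map_cons, List.map_nil, List.prod_cons, List.prod_nil, mul_one,
    List.length_append, List.length_cons, List.length_nil] at h1 h2
  have h3 := ilen_word n l
  by_cases hi : 1 ≤ i ∧ i < n
  · obtain ⟨p, rfl⟩ : ∃ p, i = p + 1 := ⟨i - 1, by omega⟩
    have hT : TT n (p+1) = sw p := by unfold TT; rw [if_pos hi]; rfl
    rw [hT] at h1
    have hy : x * sw p = (l.map (TT n)).prod := by rw [← h1, mul_sw_sw]
    rw [← hy] at h3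
    refine ⟨p, rfl, hi.2, ?_⟩
    rcases lt_or_gt_of_ne (app_ne x p) with h4 | h4
    · have := ilen_sw hi.2 x h4; omega
    · have := ilen_sw' hi.2 x h4
      exact ⟨⟨hy.symm, by omega⟩, h4⟩
  · have hT : TT n i = 1 := by unfold TT; rw [if_neg hi]
    rw [hT, mul_one] at h1
    rw [h1] at h3; omega

lemma Red_snoc {n : ℕ} {l : List ℕ} {p : ℕ} {x : Equiv.Perm ℕ} (hp : p + 1 < n)
    (h : Red n l (x * sw p)) (hx : x (p+1) < x p) : Red n (l ++ [p+1]) x := by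
  have hT : TT n (p+1) = sw p := by unfold TT; rw [if_pos (by omega)]; rfl
  refine ⟨?_, ?_⟩
  · rw [List.map_append, List.prod_append, h.1]
    simp [hT, mul_assoc]
  · rw [List.length_append, h.2]
    have := ilen_sw' hp x hx
    simpa using this

lemma exists_Red {n : ℕ} : ∀ (N : ℕ) (x : Equiv.Perm ℕ), PN n x → ilen n x = N →
    ∃ l, Red n l x := by
  intro N
  induction N with
  | zero =>
    intro x hx h
    by_cases h1 : x = 1
    · exact ⟨[], by simp [h1], by simp [h]⟩
    · obtain ⟨p, hp, hd⟩ := exists_desc hx h1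
      have := ilen_sw' hp x hd
      omega
  | succ N ih =>
    intro x hx h
    have h1 : x ≠ 1 := by rintro rfl; rw [ilen_one] at h; omega
    obtain ⟨p, hp, hd⟩ := exists_desc hx h1
    have := ilen_sw' hp x hd
    obtain ⟨l, hl⟩ := ih (x * sw p) (PN_sw hx hp) (by omega)
    exact ⟨_, Red_snoc hp hl hd⟩

lemma bl_of_sub {n : ℕ} (lw : List ℕ) : ∀ w, Red n lw w → ∀ lv v, lv.Sublist lw → Red n lv v →
    bl v w := by
  induction lw using List.reverseRecOn with
  | nil =>
    intro w hw lv v hs hv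
    rw [List.sublist_nil] at hs
    subst hs
    rw [← hw.1, ← hv.1]; exact bl_refl _
  | append_singleton l i ih =>
    intro w hw lv v hs hv
    obtain ⟨p, rfl, hp, hr, hd⟩ := Red_append hw
    have hasc : (w * sw p) p < (w * sw p) (p+1) := by rw [sw_app_l, sw_app_r]; exact hd
    rw [List.sublist_append_iff] at hs
    obtain ⟨l1, l2, rfl, hs1, hs2⟩ := hs
    rw [List.sublist_singleton] at hs2
    rcases hs2 with rfl | rfl
    · rw [List.append_nil] at hv
      refine bl_trans (ih _ hr _ _ hs1 hv) ?_
      have := bl_sw hasc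
      rwa [mul_sw_sw] at this
    · obtain ⟨q, hq, hqn, hr', hd'⟩ := Red_append hv
      obtain rfl : p = q := by omega
      have := bl_sw_sw (ih _ hr _ _ hs1 hr') hasc
      rwa [mul_sw_sw, mul_sw_sw] at this

lemma bl_dd {v w : Equiv.Perm ℕ} {p : ℕ} (h : bl v w) (hv : v (p+1) < v p) :
    bl (v * sw p) (w * sw p) := by
  have hasc : (v * sw p) p < (v * sw p) (p+1) := by rw [sw_app_l, sw_app_r]; exact hv
  refine bl_down (p := p) ?_ hasc
  rw [mul_sw_sw]
  have := bl_sw hasc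
  rw [mul_sw_sw] at this
  exact bl_trans this h

lemma sub_of_bl {n : ℕ} : ∀ (N : ℕ) (v w : Equiv.Perm ℕ), PN n v → PN n w → ilen n w = N →
    bl v w → ∃ lv lw, Red n lv v ∧ Red n lw w ∧ lv.Sublist lw := by
  intro N
  induction N with
  | zero =>
    intro v w hv hw h hb
    have h1 : w = 1 := by
      by_contra h1
      obtain ⟨p, hp, hd⟩ := exists_desc hw h1
      have := ilen_sw' hp w hd
      omega
    subst h1
    obtain rfl := bl_one hb
    exact ⟨[], [], ⟨by simp, by simp [h]⟩, ⟨by simp, by simp [h]⟩, List.Sublist.refl _⟩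
  | succ N ih =>
    intro v w hv hw h hb
    have h1 : w ≠ 1 := by rintro rfl; rw [ilen_one] at h; omega
    obtain ⟨p, hp, hd⟩ := exists_desc hw h1
    have hN := ilen_sw' hp w hd
    rcases lt_or_gt_of_ne (app_ne v p) with h4 | h4
    · obtain ⟨lv, lw, a, b, c⟩ := ih v (w * sw p) hv (PN_sw hw hp) (by omega)
        (bl_down (p := p) (by rw [mul_sw_sw]; exact hb) h4)
      exact ⟨lv, lw ++ [p+1], a, Red_snoc hp b hd, c.trans (List.sublist_append_left _ _)⟩
    · obtain ⟨lv, lw, a, b, c⟩ := ih (v * sw p) (w * sw p) (PN_sw hv hp) (PN_sw hw hp) (by omega)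
        (bl_dd hb h4)
      exact ⟨lv ++ [p+1], lw ++ [p+1], Red_snoc hp a h4, Red_snoc hp b hd,
        c.append (List.Sublist.refl _)⟩

noncomputable def phi (n : ℕ) : Equiv.Perm (Fin n) →* Equiv.Perm ℕ :=
  Equiv.Perm.extendDomainHom (Fin.equivSubtype (n := n))

lemma phi_inj (n : ℕ) : Function.Injective (phi n) := Equiv.Perm.extendDomainHom_injective _

lemma phi_fin {n : ℕ} (u : Equiv.Perm (Fin n)) (j : Fin n) : phi n u j = u j := by
  have := Equiv.Perm.extendDomain_apply_image u (Fin.equivSubtype (n := n)) j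
  exact this

lemma phi_lt {n : ℕ} (u : Equiv.Perm (Fin n)) {j : ℕ} (hj : j < n) : phi n u j = u ⟨j, hj⟩ :=
  phi_fin u ⟨j, hj⟩

lemma phi_PN {n : ℕ} (u : Equiv.Perm (Fin n)) : PN n (phi n u) := by
  intro j hj
  exact Equiv.Perm.extendDomain_apply_not_subtype u _ (by omega)

lemma phi_surj {n : ℕ} {x : Equiv.Perm ℕ} (hx : PN n x) : ∃ u, phi n u = x := by
  have hx' : PN n x⁻¹ := by
    intro j hj
    rw [Equiv.Perm.inv_eq_iff_eq]
    exact (hx j hj).symm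
  refine ⟨⟨fun j => ⟨x j, PN_lt hx j.2⟩, fun j => ⟨x⁻¹ j, PN_lt hx' j.2⟩, ?_, ?_⟩, ?_⟩
  · intro j; ext; simp
  · intro j; ext; simp
  · ext j
    by_cases hj : j < n
    · rw [phi_lt _ hj]; rfl
    · rw [phi_PN _ j (by omega), hx j (by omega)]

lemma phi_simple (n i : ℕ) : phi n (simpleT n i) = TT n i := by
  unfold simpleT TT
  split_ifs with h
  · ext j
    by_cases hj : j < n
    · rw [phi_lt _ hj, Equiv.swap_apply_def, Equiv.swap_apply_def]
      simp only [Fin.ext_iff]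
      split_ifs <;> simp <;> omega
    · rw [phi_PN _ j (by omega), Equiv.swap_apply_of_ne_of_ne (by omega) (by omega)]
  · exact map_one _

lemma phi_word (n : ℕ) (l : List ℕ) :
    phi n (l.map (simpleT n)).prod = (l.map (TT n)).prod := by
  rw [map_list_prod, List.map_map]
  congr 1
  apply List.map_congr_left
  intro i _
  exact phi_simple n i

lemma permLen_eq (n : ℕ) (w : Equiv.Perm (Fin n)) : permLen n w = ilen n (phi n w) := by
  unfold permLen
  obtain ⟨l, hl⟩ := exists_Red _ _ (phi_PN w) rfl
  apply le_antisymm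
  · apply Nat.sInf_le
    refine ⟨l, hl.2, ?_⟩
    apply phi_inj
    rw [phi_word]; exact hl.1
  · apply le_csInf
    · exact ⟨_, l, rfl, phi_inj n (by rw [phi_word]; exact hl.1)⟩
    · rintro k ⟨l', rfl, h⟩
      rw [← h, phi_word]
      exact ilen_word n l'

lemma red_iff (n : ℕ) (l : List ℕ) (w : Equiv.Perm (Fin n)) :
    IsReducedWord n l w ↔ Red n l (phi n w) := by
  unfold IsReducedWord Red
  rw [permLen_eq, ← phi_word]
  constructor
  · rintro ⟨h, h'⟩; exact ⟨by rw [h], h'⟩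
  · rintro ⟨h, h'⟩; exact ⟨phi_inj n h, h'⟩

lemma bruhat_iff (n : ℕ) (v w : Equiv.Perm (Fin n)) :
    bruhatLE n v w ↔ bl (phi n v) (phi n w) := by
  constructor
  · rintro ⟨lv, lw, h1, h2, h3⟩
    exact bl_of_sub lw _ ((red_iff _ _ _).1 h2) lv _ h3 ((red_iff _ _ _).1 h1)
  · intro h
    obtain ⟨lv, lw, h1, h2, h3⟩ := sub_of_bl _ _ _ (phi_PN v) (phi_PN w) rfl h
    exact ⟨lv, lw, (red_iff _ _ _).2 h1, (red_iff _ _ _).2 h2, h3⟩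

lemma supp_pres {n r : ℕ} {w : Equiv.Perm (Fin n)} (hw : r ∉ permSupp n w) :
    ∀ j < r, phi n w j < r := by
  obtain ⟨l, hl⟩ := exists_Red _ _ (phi_PN w) rfl
  have hr : r ∉ l := fun h => hw ⟨l, (red_iff _ _ _).2 hl, h⟩
  rw [← hl.1]
  clear hl hw
  induction l with
  | nil => intro j hj; simpa using hj
  | cons i l ih =>
    intro j hj
    rw [List.mem_cons] at hr
    push Not at hr
    have := ih hr.2 j hj
    rw [List.map_cons, List.prod_cons, Equiv.Perm.mul_apply]
    unfold TT at *
    split_ifs with h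
    · rw [Equiv.swap_apply_def]
      split_ifs <;> omega
    · exact this

end part2

section part3
open Finset

section poly
variable {E E' V : Type*} [NormedAddCommGroup E] [NormedSpace ℝ E] [FiniteDimensional ℝ E]
  [NormedAddCommGroup E'] [NormedSpace ℝ E'] [FiniteDimensional ℝ E'] [Fintype V]

lemma mem_conv_iff (p : V → E) (S : Set V) (x : E) : x ∈ convexHull ℝ (p '' S) ↔
    ∃ w : V → ℝ, (∀ v, 0 ≤ w v) ∧ (∀ v, v ∉ S → w v = 0) ∧ ∑ v, w v = 1 ∧ ∑ v, w v • p v = x := by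
  classical
  constructor
  · intro hx
    let T : Set E := {x | ∃ w : V → ℝ, (∀ v, 0 ≤ w v) ∧ (∀ v, v ∉ S → w v = 0) ∧
      ∑ v, w v = 1 ∧ ∑ v, w v • p v = x}
    have hT : Convex ℝ T := by
      rintro x ⟨w, h1, h2, h3, h4⟩ y ⟨w', h1', h2', h3', h4'⟩ a b ha hb hab
      refine ⟨fun v => a * w v + b * w' v, ?_, ?_, ?_, ?_⟩
      · intro v
        have := mul_nonneg ha (h1 v)
        have := mul_nonneg hb (h1' v)
        linarith
      · intro v hv
        simp only [h2 v hv, h2' v hv]; ring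
      · rw [sum_add_distrib, ← mul_sum, ← mul_sum, h3, h3']; linarith
      · simp only [add_smul, mul_smul]
        rw [sum_add_distrib, ← smul_sum, ← smul_sum, h4, h4']
    refine convexHull_min (t := T) ?_ hT hx
    rintro _ ⟨v, hv, rfl⟩
    refine ⟨fun u => if u = v then 1 else 0, ?_, ?_, ?_, ?_⟩
    · intro u; dsimp only; split_ifs <;> norm_num
    · intro u hu
      have : u ≠ v := by rintro rfl; exact hu hv
      simp [this]
    · simp
    · simp
  · rintro ⟨w, h1, h2, h3, rfl⟩
    have e1 : ∑ v ∈ univ.filter (· ∈ S), w v = 1 := by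
      rw [← h3]; apply sum_subset (subset_univ _)
      intro v _ hv; apply h2; simpa using hv
    have e2 : ∑ v ∈ univ.filter (· ∈ S), w v • p v = ∑ v, w v • p v := by
      apply sum_subset (subset_univ _)
      intro v _ hv; rw [h2, zero_smul]; simpa using hv
    rw [← e2]
    apply (convex_convexHull ℝ _).sum_mem (fun v _ => h1 v) e1
    intro v hv
    apply subset_convexHull
    exact ⟨v, by simpa using hv, rfl⟩

def IsArg (p : V → E) (G : Set V) : Prop :=
  ∃ f : E →L[ℝ] ℝ, G = {v | ∀ u, f (p u) ≤ f (p v)}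

lemma face_pos (p : V → E) {F : Set E} (hF : IsFaceOf (convexHull ℝ (Set.range p)) F)
    (w : V → ℝ) (h0 : ∀ v, 0 ≤ w v) (h1 : ∑ v, w v = 1) (hx : ∑ v, w v • p v ∈ F)
    (v : V) (hv : 0 < w v) : p v ∈ F := by
  classical
  have hle : w v ≤ 1 := by rw [← h1]; exact single_le_sum (fun i _ => h0 i) (mem_univ v)
  have hs : ∑ u ∈ univ.erase v, w u = 1 - w v := by
    rw [← h1, ← sum_erase_add univ w (mem_univ v)]; ring
  have hp : ∑ u ∈ univ.erase v, w u • p u = ∑ u, w u • p u - w v • p v := by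
    rw [← sum_erase_add univ (fun u => w u • p u) (mem_univ v)]; simp
  rcases hle.lt_or_eq with hlt | heq
  · have hpos : 0 < 1 - w v := by linarith
    let z := ∑ u ∈ univ.erase v, (w u / (1 - w v)) • p u
    have hz : z ∈ convexHull ℝ (Set.range p) := by
      apply (convex_convexHull ℝ _).sum_mem
      · intro i _; exact div_nonneg (h0 i) hpos.le
      · rw [← sum_div, hs]; field_simp
      · intro i _; exact subset_convexHull ℝ _ ⟨i, rfl⟩
    refine hF.1.left_mem_of_mem_openSegment (subset_convexHull ℝ _ ⟨v, rfl⟩) hz hx ?_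
    refine ⟨w v, 1 - w v, hv, hpos, by ring, ?_⟩
    have : (1 - w v) • z = ∑ u ∈ univ.erase v, w u • p u := by
      rw [smul_sum]; apply sum_congr rfl; intro i _
      rw [smul_smul]; congr 1; field_simp
    rw [this, hp]; abel
  · rw [heq, sub_self] at hs
    have hz : ∑ u ∈ univ.erase v, w u • p u = 0 := by
      apply sum_eq_zero
      intro i hi
      rw [(sum_eq_zero_iff_of_nonneg (fun i _ => h0 i)).1 hs i hi, zero_smul]
    rw [hp, sub_eq_zero, heq, one_smul] at hz
    rwa [hz] at hx

lemma face_eq (p : V → E) {F : Set E} (hF : IsFaceOf (convexHull ℝ (Set.range p)) F) :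
    F = convexHull ℝ (p '' (p ⁻¹' F)) := by
  apply Set.Subset.antisymm
  · intro x hx
    have hx' := hF.1.1 hx
    rw [← Set.image_univ, mem_conv_iff] at hx'
    obtain ⟨w, h0, -, h1, h2⟩ := hx'
    rw [mem_conv_iff]
    refine ⟨w, h0, ?_, h1, h2⟩
    intro v hv
    by_contra hne
    exact hv (face_pos p hF w h0 h1 (by rw [h2]; exact hx) v (lt_of_le_of_ne (h0 v) (Ne.symm hne)))
  · apply convexHull_min _ hF.2
    rintro _ ⟨v, hv, rfl⟩; exact hv

lemma face_arg (p : V → E) {F : Set E} (hF : IsFaceOf (convexHull ℝ (Set.range p)) F)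
    (hne : (p ⁻¹' F).Nonempty) : IsArg p (p ⁻¹' F) := by
  classical
  obtain ⟨g0, hg0⟩ := hne
  set G := p ⁻¹' F with hG
  let q : V → E := fun v => p v - p g0
  let b : V → E := fun i => if i ∈ G then p i - p g0 else 0
  let t : Submodule ℝ E := Submodule.span ℝ (Set.range b)
  have hdis : Disjoint (convexHull ℝ (q '' Gᶜ)) (t : Set E) := by
    rw [Set.disjoint_left]
    intro x hx hxt
    rw [mem_conv_iff] at hx
    obtain ⟨w, h0, hG0, h1, h2⟩ := hx
    obtain ⟨c, hc⟩ := (Submodule.mem_span_range_iff_exists_fun ℝ).1 hxt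
    -- truncated coefficients
    let d : V → ℝ := fun i => if i ∈ G then c i else 0
    have hd : ∑ i, d i • p i - (∑ i, d i) • p g0 = x := by
      rw [← hc, sum_smul, ← sum_sub_distrib]
      apply sum_congr rfl; intro i _
      simp only [d, b]
      split_ifs <;> simp [smul_sub]
    have hw : ∑ i, w i • p i - p g0 = x := by
      rw [← h2]; simp only [q, smul_sub]
      rw [sum_sub_distrib, ← sum_smul, h1, one_smul]
    let K := ∑ i, |d i|
    have hK : ∑ i, d i ≤ K := sum_le_sum fun i _ => le_abs_self _
    have hK0 : 0 ≤ K := sum_nonneg fun i _ => abs_nonneg _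
    let N := 1 + 2 * K - ∑ i, d i
    have hN : 0 < N := by simp only [N]; linarith
    let δ : V → ℝ := fun i => if i = g0 then 1 else 0
    have hδ : ∑ i, δ i = 1 := by simp [δ]
    have hδp : ∑ i, δ i • p i = p g0 := by simp [δ]
    have hδ0 : ∀ i, 0 ≤ δ i := fun i => by simp only [δ]; split_ifs <;> norm_num
    let W1 : V → ℝ := fun i => N⁻¹ * (w i + (|d i| - d i) + K * δ i)
    let W2 : V → ℝ := fun i => N⁻¹ * (|d i| + (1 + K - ∑ i, d i) * δ i)
    have eq1 : ∑ i, W1 i • p i = ∑ i, W2 i • p i := by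
      have l1 : ∑ i, W1 i • p i = N⁻¹ • (∑ i, w i • p i + (∑ i, |d i| • p i - ∑ i, d i • p i)
          + K • p g0) := by
        rw [← hδp, smul_sum, ← sum_sub_distrib, ← sum_add_distrib, ← sum_add_distrib, smul_sum]
        apply sum_congr rfl; intro i _; simp only [W1]; module
      have l2 : ∑ i, W2 i • p i = N⁻¹ • (∑ i, |d i| • p i + (1 + K - ∑ i, d i) • p g0) := by
        conv_rhs => rw [← hδp]
        rw [smul_sum, ← sum_add_distrib, smul_sum]
        apply sum_congr rfl; intro i _; simp only [W2]; module
      rw [l1, l2]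
      congr 1
      have e1 : ∑ i, w i • p i = x + p g0 := by rw [← hw]; abel
      have e2 : ∑ i, d i • p i = x + (∑ i, d i) • p g0 := by rw [← hd]; abel
      rw [e1, e2]; module
    have hy : ∑ i, W2 i • p i ∈ F := by
      rw [face_eq p hF, mem_conv_iff]
      refine ⟨W2, ?_, ?_, ?_, rfl⟩
      · intro i
        apply mul_nonneg (inv_nonneg.2 hN.le)
        apply add_nonneg (abs_nonneg _) (mul_nonneg _ (hδ0 i))
        linarith
      · intro i hi
        have : i ≠ g0 := by rintro rfl; exact hi hg0
        have h3 : i ∉ G := hi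
        simp [W2, d, δ, this, h3]
      · simp only [W2]
        rw [← mul_sum, sum_add_distrib, ← mul_sum, hδ, inv_mul_eq_one₀ hN.ne']
        simp only [N, K]; ring
    obtain ⟨v, hv⟩ : ∃ v, 0 < w v := by
      by_contra hcon
      push Not at hcon
      have : ∑ v, w v ≤ 0 := sum_nonpos fun v _ => hcon v
      linarith
    have hvG : v ∉ G := by
      intro hvG
      have := hG0 v (by simpa using hvG)
      linarith
    apply hvG
    rw [← eq1] at hy
    refine face_pos p hF W1 ?_ ?_ hy v ?_
    · intro i
      apply mul_nonneg (inv_nonneg.2 hN.le)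
      have := h0 i
      have := le_abs_self (d i)
      have := mul_nonneg hK0 (hδ0 i)
      linarith
    · simp only [W1]
      rw [← mul_sum, sum_add_distrib, sum_add_distrib, ← mul_sum, hδ, sum_sub_distrib, h1,
        inv_mul_eq_one₀ hN.ne']
      simp only [N, K]; ring
    · apply mul_pos (inv_pos.2 hN)
      have := le_abs_self (d v)
      have := mul_nonneg hK0 (hδ0 v)
      linarith
  obtain ⟨f, u, u', hf1, huv, hf2⟩ := geometric_hahn_banach_compact_closed
    (convex_convexHull ℝ _) (Set.Finite.isCompact_convexHull (𝕜 := ℝ) (Set.toFinite (q '' Gᶜ))) t.convex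
    (Submodule.closed_of_finiteDimensional t) hdis
  have hu' : u' < 0 := by simpa using hf2 0 t.zero_mem
  have hzero : ∀ y ∈ t, f y = 0 := by
    intro y hy
    by_contra hne
    have := hf2 ((u' / f y) • y) (t.smul_mem _ hy)
    rw [map_smul, smul_eq_mul, div_mul_cancel₀ _ hne] at this
    exact lt_irrefl _ this
  have hGc : ∀ v ∈ G, f (p v) = f (p g0) := by
    intro v hv
    have : f (b v) = 0 := hzero _ (Submodule.subset_span ⟨v, rfl⟩)
    simp only [b, if_pos hv, map_sub] at this
    linarith
  have hlt : ∀ v, v ∉ G → f (p v) < f (p g0) := by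
    intro v hv
    have := hf1 (q v) (subset_convexHull ℝ _ ⟨v, hv, rfl⟩)
    simp only [q, map_sub] at this
    linarith
  refine ⟨f, ?_⟩
  ext v
  constructor
  · intro hv u
    rw [hGc v hv]
    by_cases hu : u ∈ G
    · rw [hGc u hu]
    · exact (hlt u hu).le
  · intro hv
    by_contra hvG
    have := hv g0
    have := hlt v hvG
    linarith

lemma arg_face (p : V → E) {G : Set V} (hG : IsArg p G) (hne : G.Nonempty) :
    IsFaceOf (convexHull ℝ (Set.range p)) (convexHull ℝ (p '' G)) ∧
    p ⁻¹' (convexHull ℝ (p '' G)) = G := by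
  obtain ⟨f, rfl⟩ := hG
  obtain ⟨v0, hv0⟩ := hne
  set G := {v | ∀ u, f (p u) ≤ f (p v)} with hG
  have hM : ∀ v ∈ G, f (p v) = f (p v0) := fun v hv => le_antisymm (hv0 v) (hv v0)
  have hval : ∀ x ∈ convexHull ℝ (p '' G), f x = f (p v0) := by
    intro x hx
    have hc : Convex ℝ {x | f x = f (p v0)} := convex_hyperplane f.isLinear _
    refine convexHull_min ?_ hc hx
    rintro _ ⟨v, hv, rfl⟩; exact hM v hv
  have hle : ∀ x ∈ convexHull ℝ (Set.range p), f x ≤ f (p v0) := by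
    intro x hx
    have hc : Convex ℝ {x | f x ≤ f (p v0)} := convex_halfSpace_le f.isLinear _
    refine convexHull_min ?_ hc hx
    rintro _ ⟨v, rfl⟩; exact hv0 v
  have heq : convexHull ℝ (p '' G) = {x ∈ convexHull ℝ (Set.range p) |
      ∀ y ∈ convexHull ℝ (Set.range p), f y ≤ f x} := by
    ext x
    constructor
    · intro hx
      refine ⟨convexHull_mono (Set.image_subset_range _ _) hx, ?_⟩
      intro y hy
      rw [hval x hx]; exact hle y hy
    · rintro ⟨hx, hx2⟩
      have hfx : f x = f (p v0) := le_antisymm (hle x hx) (hx2 _ (subset_convexHull ℝ _ ⟨v0, rfl⟩))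
      rw [← Set.image_univ, mem_conv_iff] at hx
      obtain ⟨w, h0, -, h1, h2⟩ := hx
      rw [mem_conv_iff]
      refine ⟨w, h0, ?_, h1, h2⟩
      have hs : ∑ v, w v * (f (p v0) - f (p v)) = 0 := by
        have : f x = ∑ v, w v * f (p v) := by rw [← h2, map_sum]; simp
        simp only [mul_sub]
        rw [sum_sub_distrib, ← sum_mul, h1, ← this, hfx]; ring
      rw [sum_eq_zero_iff_of_nonneg (fun v _ => mul_nonneg (h0 v) (sub_nonneg.2 (hv0 v)))] at hs
      intro v hv
      rcases mul_eq_zero.1 (hs v (mem_univ v)) with h | h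
      · exact h
      · exfalso; apply hv; intro u; have := hv0 u; linarith
  refine ⟨⟨?_, convex_convexHull ℝ _⟩, ?_⟩
  · rw [heq]
    apply IsExposed.isExtreme
    intro _; exact ⟨f, rfl⟩
  · ext v
    constructor
    · intro hv u
      have := hval _ hv
      rw [this]; exact hv0 u
    · intro hv
      exact subset_convexHull ℝ _ ⟨v, hv, rfl⟩

def FSet (p : V → E) (G : Set V) : Prop := G = ∅ ∨ IsArg p G

lemma face_FSet (p : V → E) {F : Set E} (hF : IsFaceOf (convexHull ℝ (Set.range p)) F) :
    FSet p (p ⁻¹' F) := by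
  rcases Set.eq_empty_or_nonempty (p ⁻¹' F) with h | h
  · exact Or.inl h
  · exact Or.inr (face_arg p hF h)

lemma FSet_face (p : V → E) {G : Set V} (hG : FSet p G) :
    IsFaceOf (convexHull ℝ (Set.range p)) (convexHull ℝ (p '' G)) ∧
    p ⁻¹' (convexHull ℝ (p '' G)) = G := by
  rcases Set.eq_empty_or_nonempty G with h | h
  · subst h
    simp only [Set.image_empty, convexHull_empty, Set.preimage_empty, and_true]
    exact ⟨⟨Set.empty_subset _, by simp⟩, convex_empty⟩
  · rcases hG with rfl | hG
    · simp at h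
    · exact arg_face p hG h

theorem combEquiv_of_arg (p : V → E) (p' : V → E') (h : ∀ G, IsArg p G ↔ IsArg p' G) :
    CombEquiv (convexHull ℝ (Set.range p)) (convexHull ℝ (Set.range p')) := by
  have hF : ∀ G, FSet p G ↔ FSet p' G := fun G => by unfold FSet; rw [h]
  refine ⟨⟨fun A => ⟨_, (FSet_face p' ((hF _).1 (face_FSet p A.2))).1⟩,
    fun B => ⟨_, (FSet_face p ((hF _).2 (face_FSet p' B.2))).1⟩, ?_, ?_⟩, ?_⟩
  · intro A
    apply Subtype.ext
    dsimp only
    rw [(FSet_face p' ((hF _).1 (face_FSet p A.2))).2, ← face_eq p A.2]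
  · intro B
    apply Subtype.ext
    dsimp only
    rw [(FSet_face p ((hF _).2 (face_FSet p' B.2))).2, ← face_eq p' B.2]
  · intro A B
    dsimp only [Equiv.coe_fn_mk]
    constructor
    · intro hAB
      exact convexHull_mono (Set.image_mono (Set.preimage_mono hAB))
    · intro hAB
      have := Set.preimage_mono (f := p') hAB
      rw [(FSet_face p' ((hF _).1 (face_FSet p A.2))).2,
        (FSet_face p' ((hF _).1 (face_FSet p B.2))).2] at this
      rw [face_eq p A.2, face_eq p B.2]
      exact convexHull_mono (Set.image_mono this)
end poly

end part3

section part4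
open Finset

def SS (k : ℕ) (x y : Equiv.Perm ℕ) : Prop := ∀ a < k, y.symm (x a) < k

lemma rk_diff (v : Equiv.Perm ℕ) {h k m m0 : ℕ} (hk : h ≤ k) (hm : m ≤ m0) :
    rk v h m + rk v k m0 ≤ rk v k m + rk v h m0 := by
  induction k, hk using Nat.le_induction with
  | base => omega
  | succ k _ ih => rw [rk_succ, rk_succ]; split_ifs <;> omega

lemma rk_diff_eq (v : Equiv.Perm ℕ) {h k m m0 : ℕ} (hk : h ≤ k) (hm : m ≤ m0)
    (hj : ∀ j, h ≤ j → j < k → ¬ (m ≤ v j ∧ v j < m0)) :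
    rk v h m + rk v k m0 = rk v k m + rk v h m0 := by
  induction k, hk using Nat.le_induction with
  | base => omega
  | succ k hk ih =>
    have := ih fun j h1 h2 => hj j h1 (by omega)
    have := hj k hk (by omega)
    rw [rk_succ, rk_succ]; split_ifs <;> omega

def mu (n : ℕ) (x : Equiv.Perm ℕ) : ℕ := ∑ h ∈ range n, ∑ m ∈ range n, rk x h m

lemma swap_lower {n l q : ℕ} {v x : Equiv.Perm ℕ} (hx : PN n x) (hlq : l < q) (hq : q < n)
    (hd : x q < x l) (hb : bl v x)
    (hv : ∀ h m, l < h → h ≤ q → x q < m → m ≤ x l → rk v h m < rk x h m) :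
    PN n (x * Equiv.swap l q) ∧ bl (x * Equiv.swap l q) x ∧ bl v (x * Equiv.swap l q) ∧
      mu n (x * Equiv.swap l q) < mu n x := by
  have key := rk_swap x l q hlq
  have hle : bl (x * Equiv.swap l q) x := by
    intro h m
    have := key h m
    split_ifs at this <;> omega
  refine ⟨?_, hle, ?_, ?_⟩
  · intro j hj
    rw [Equiv.Perm.mul_apply, Equiv.swap_apply_of_ne_of_ne (by omega) (by omega), hx j hj]
  · intro h m
    have h1 := key h m
    have h2 := hb h m
    by_cases hc : (l < h ∧ h ≤ q) ∧ (x q < m ∧ m ≤ x l)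
    · have := hv h m hc.1.1 hc.1.2 hc.2.1 hc.2.2
      split_ifs at h1 <;> omega
    · split_ifs at h1 <;> omega
  · unfold mu
    have hxl : x l < n := PN_lt hx (by omega)
    apply sum_lt_sum
    · intro h _
      exact sum_le_sum fun m _ => hle h m
    · refine ⟨q, mem_range.2 hq, ?_⟩
      apply sum_lt_sum
      · intro m _; exact hle q m
      · refine ⟨x l, mem_range.2 hxl, ?_⟩
        have := key q (x l)
        split_ifs at this <;> omega

lemma lemC_I {n p : ℕ} {v x : Equiv.Perm ℕ} (hx : PN n x) (hp : p + 1 < n) (hb : bl v x)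
    (hv : PN n v) (h : x p < v p) :
    ∃ l < p, PN n (x * Equiv.swap l p) ∧ bl (x * Equiv.swap l p) x ∧
      bl v (x * Equiv.swap l p) ∧ mu n (x * Equiv.swap l p) < mu n x := by
  classical
  have hS : ∀ m, m ≤ v p → rk v p m < rk x (p+1) m := by
    intro m hm
    have := hb (p+1) m
    rw [rk_succ, if_pos hm] at this
    omega
  have hex : ∃ m, rk x (p+1) m ≤ rk v p m := by
    refine ⟨n, ?_⟩
    have : rk x (p+1) n = 0 := by
      rw [rk_eq_zero]; intro j hj; exact PN_lt hx (by omega)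
    omega
  obtain ⟨m0, hm0, hmin⟩ : ∃ m0, rk x (p+1) m0 ≤ rk v p m0 ∧
      ∀ m < m0, rk v p m < rk x (p+1) m :=
    ⟨Nat.find hex, Nat.find_spec hex, fun m hm => not_le.1 (Nat.find_min hex hm)⟩
  have hm0p : v p < m0 := by
    by_contra hc
    have := hS m0 (by omega)
    omega
  obtain ⟨m, rfl⟩ : ∃ m, m0 = m + 1 := ⟨m0 - 1, by omega⟩
  have h1 := hmin m (by omega)
  have h2 := rk_step_m x (p+1) m
  have h3 := rk_step_m v p m
  have hpos : x.symm m < p + 1 := by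
    by_contra hc
    rw [if_neg hc] at h2
    omega
  have hxm : x (x.symm m) = m := x.apply_symm_apply m
  have hposp : x.symm m < p := by
    rcases Nat.lt_succ_iff_lt_or_eq.1 hpos with h' | h'
    · exact h'
    · rw [h'] at hxm; omega
  let P : ℕ → Prop := fun l => l < p ∧ x p < x l ∧ x l < m + 1
  have hP : P (x.symm m) := ⟨hposp, by omega, by omega⟩
  have hPl := Nat.findGreatest_spec (P := P) (n := p) hposp.le hP
  set l := Nat.findGreatest P p with hl
  have hgr : ∀ j, l < j → j < p → ¬ (x p < x j ∧ x j < m + 1) := by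
    intro j h1 h2 h3
    exact Nat.findGreatest_is_greatest (P := P) h1 h2.le ⟨h2, h3⟩
  obtain ⟨hl1, hl2, hl3⟩ := hPl
  refine ⟨l, hl1, swap_lower hx hl1 (by omega) hl2 hb ?_⟩
  intro h m' a1 a2 a3 a4
  have e1 := rk_diff_eq x (h := h) (k := p+1) (m := m') (m0 := m+1) (by omega) (by omega) (by
    intro j b1 b2 b3
    rcases Nat.lt_succ_iff_lt_or_eq.1 b2 with b4 | b4
    · exact hgr j (by omega) b4 ⟨by omega, b3.2⟩
    · subst b4; omega)
  have e2 := rk_diff v (h := h) (k := p) (m := m') (m0 := m+1) a2 (by omega)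
  have e3 := hmin m' (by omega)
  have e4 := hb h (m+1)
  omega

lemma PN_inv {n : ℕ} {x : Equiv.Perm ℕ} (hx : PN n x) : PN n x⁻¹ := by
  intro j hj
  rw [Equiv.Perm.inv_eq_iff_eq]
  exact (hx j hj).symm

lemma lemC_II {n p : ℕ} {v x : Equiv.Perm ℕ} (hx : PN n x) (hp : p + 1 < n) (hb : bl v x)
    (h : v (p+1) < x (p+1)) :
    ∃ l, p + 1 < l ∧ PN n (x * Equiv.swap (p+1) l) ∧ bl (x * Equiv.swap (p+1) l) x ∧
      bl v (x * Equiv.swap (p+1) l) ∧ mu n (x * Equiv.swap (p+1) l) < mu n x := by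
  classical
  have hbig : ∀ m, v (p+1) < m → rk v (p+2) m ≤ rk x (p+1) m := by
    intro m hm
    have := hb (p+1) m
    rw [rk_succ, if_neg (by omega)]; omega
  let P : ℕ → Prop := fun m => rk x (p+1) m < rk v (p+2) m
  have hP0 : P 0 := by simp [P, rk]
  have hspec := Nat.findGreatest_spec (P := P) (n := v (p+1)) (Nat.zero_le _) hP0
  have hle := Nat.findGreatest_le (P := P) (v (p+1))
  set m1 := Nat.findGreatest P (v (p+1)) with hm1
  have hgr : ∀ m, m1 < m → rk v (p+2) m ≤ rk x (p+1) m := by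
    intro m hm
    by_cases hc : v (p+1) < m
    · exact hbig m hc
    · exact not_lt.1 (Nat.findGreatest_is_greatest (P := P) hm (by omega))
  have hs : rk x (p+1) m1 < rk v (p+2) m1 := hspec
  have h2 := rk_step_m x (p+1) m1
  have h3 := rk_step_m v (p+2) m1
  have h4 := hgr (m1+1) (by omega)
  have hxm : x (x.symm m1) = m1 := x.apply_symm_apply m1
  have hpos : p + 1 < x.symm m1 := by
    by_contra hc
    by_cases hc' : x.symm m1 = p + 1
    · rw [hc'] at hxm; omega
    · rw [if_pos (by omega)] at h2
      split_ifs at h3 <;> omega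
  have hlt : x (p+1) < n := PN_lt hx hp
  have hposn : x.symm m1 < n := PN_lt (PN_inv hx) (by omega : m1 < n)
  have hex : ∃ l, p + 1 < l ∧ m1 ≤ x l ∧ x l < x (p+1) := ⟨x.symm m1, hpos, by omega, by omega⟩
  obtain ⟨hl1, hl2, hl3⟩ := Nat.find_spec hex
  have hln : Nat.find hex < n :=
    lt_of_le_of_lt (Nat.find_min' hex ⟨hpos, by omega, by omega⟩) hposn
  have hmin : ∀ j, p + 1 < j → j < Nat.find hex → ¬ (m1 ≤ x j ∧ x j < x (p+1)) :=
    fun j a b c => Nat.find_min hex b ⟨a, c⟩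
  set l := Nat.find hex with hl
  refine ⟨l, hl1, swap_lower hx hl1 hln hl3 hb ?_⟩
  intro h m a1 a2 a3 a4
  have e1 := rk_diff_eq x (h := p+1) (k := h) (m := m1) (m0 := m) (by omega) (by omega) (by
    intro j b1 b2 b3
    rcases Nat.lt_or_eq_of_le b1 with b4 | b4
    · exact hmin j b4 (by omega) ⟨b3.1, by omega⟩
    · subst b4; omega)
  have e2 := rk_diff v (h := p+2) (k := h) (m := m1) (m0 := m) (by omega) (by omega)
  have e3 := hgr m (by omega)
  have e4 := hb h m1
  omega

lemma SS_refl (k x) : SS k x x := fun a ha => by simpa using ha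

lemma SS_trans {k x y z} (h : SS k x y) (h' : SS k y z) : SS k x z := by
  intro a ha
  have := h' _ (h a ha)
  simpa using this

lemma lemC {n p : ℕ} {v : Equiv.Perm ℕ} (hp : p + 1 < n) (hv : PN n v) (hvp : v (p+1) < v p) :
    ∀ (N : ℕ) (x : Equiv.Perm ℕ), mu n x = N → PN n x → bl v x →
    ∃ z, PN n z ∧ bl v z ∧ bl z x ∧ SS (p+1) z x ∧ z (p+1) < z p := by
  intro N
  induction N using Nat.strong_induction_on with
  | _ N ih =>
    intro x hN hx hb
    by_cases hd : x (p+1) < x p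
    · exact ⟨x, hx, hb, bl_refl x, SS_refl _ _, hd⟩
    · by_cases h1 : x p < v p
      · obtain ⟨l, hl, c1, c2, c3, c4⟩ := lemC_I hx hp hb hv h1
        obtain ⟨z, z1, z2, z3, z4, z5⟩ := ih _ (by omega) _ rfl c1 c3
        refine ⟨z, z1, z2, bl_trans z3 c2, SS_trans z4 ?_, z5⟩
        intro a ha
        rw [Equiv.Perm.mul_apply, Equiv.symm_apply_apply, Equiv.swap_apply_def]
        split_ifs <;> omega
      · obtain ⟨l, hl, c1, c2, c3, c4⟩ := lemC_II hx hp hb (by omega)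
        obtain ⟨z, z1, z2, z3, z4, z5⟩ := ih _ (by omega) _ rfl c1 c3
        refine ⟨z, z1, z2, bl_trans z3 c2, SS_trans z4 ?_, z5⟩
        intro a ha
        rw [Equiv.Perm.mul_apply, Equiv.symm_apply_apply, Equiv.swap_apply_def]
        split_ifs <;> omega

end part4

section part5
open Finset

noncomputable def DD (g : ℕ → ℕ → ℝ) (f : ℕ → ℕ) (k : ℕ) : ℝ :=
  Matrix.det (Matrix.of fun a b : Fin k => g (f a) b)

lemma DD_congr {g g' : ℕ → ℕ → ℝ} {f f' : ℕ → ℕ} {k : ℕ}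
    (h : ∀ a < k, ∀ b < k, g (f a) b = g' (f' a) b) : DD g f k = DD g' f' k := by
  unfold DD
  congr 1
  ext a b
  exact h a a.2 b b.2

lemma DD_col {g g' : ℕ → ℕ → ℝ} (f : ℕ → ℕ) (m k : ℕ) (c : ℕ → ℝ) (hk : c k = 0)
    (hm : m ≤ k → ∀ b < m, c b = 0) (h : ∀ r b, g' r b = g r b + c b * g r k) :
    DD g' f m = DD g f m := by
  by_cases hkm : m ≤ k
  · apply DD_congr
    intro a _ b hb
    rw [h, hm hkm b hb]; ring
  · unfold DD
    rw [← Matrix.det_transpose, ← Matrix.det_transpose (Matrix.of fun a b : Fin m => g (f a) b)]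
    refine Matrix.det_eq_of_forall_row_eq_smul_add_const (fun b => c b) ⟨k, by omega⟩ hk ?_
    intro i j
    simp [h]

lemma DD_last (g : ℕ → ℕ → ℝ) (f : ℕ → ℕ) (k : ℕ) : ∃ C : ℕ → ℝ, ∀ g' : ℕ → ℕ → ℝ,
    (∀ r, ∀ b < k, g' r b = g r b) → DD g' f (k+1) = ∑ a ∈ range (k+1), g' (f a) k * C a := by
  classical
  refine ⟨fun a => if h : a < k + 1 then (-1) ^ (a + k) * Matrix.det
    ((Matrix.of fun a b : Fin (k+1) => g (f a) b).submatrix (Fin.succAbove ⟨a, h⟩)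
      (Fin.succAbove (Fin.last k))) else 0, ?_⟩
  intro g' hg
  unfold DD
  rw [Matrix.det_succ_column _ (Fin.last k), Finset.sum_range]
  apply sum_congr rfl
  intro a _
  dsimp only
  rw [dif_pos (show (a:ℕ) < k + 1 from a.2)]
  have : (Matrix.of fun a b : Fin (k+1) => g' (f a) b).submatrix (Fin.succAbove a)
      (Fin.succAbove (Fin.last k)) = (Matrix.of fun a b : Fin (k+1) => g (f a) b).submatrix
      (Fin.succAbove ⟨a, a.2⟩) (Fin.succAbove (Fin.last k)) := by
    ext i j
    simp [hg]
  rw [this]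
  simp
  ring

lemma DD_perm (x y : Equiv.Perm ℕ) (k : ℕ) (h : SS k x y) :
    ∃ s : ℝ, s * s = 1 ∧ ∀ g, DD g x k = s * DD g y k := by
  classical
  let t : Fin k → Fin k := fun a => ⟨y.symm (x a), h a a.2⟩
  have ht : Function.Injective t := by
    intro a b hab
    have := congrArg Fin.val hab
    simp only [t] at this
    exact Fin.ext (x.injective (y.symm.injective this))
  let σ : Equiv.Perm (Fin k) := Equiv.ofBijective t (Finite.injective_iff_bijective.1 ht)
  refine ⟨((Equiv.Perm.sign σ : ℤ) : ℝ), ?_, ?_⟩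
  · rw [← Int.cast_mul, ← Units.val_mul, Int.units_mul_self]; simp
  · intro g
    unfold DD
    rw [← Matrix.det_permute]
    congr 1
    ext a b
    simp [σ, t]

noncomputable def vd : ℕ → ℕ → ℝ := fun r b => (r : ℝ) ^ b

lemma vd_prod (x : ℕ → ℕ) (k : ℕ) : DD vd x k =
    ∏ i ∈ range k, ∏ j ∈ range k, if i < j then ((x j : ℝ) - x i) else 1 := by
  have : DD vd x k = Matrix.det (Matrix.vandermonde fun a : Fin k => (x a : ℝ)) := by
    unfold DD; congr 1
  rw [this, Matrix.det_vandermonde, Finset.prod_range]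
  apply prod_congr rfl
  intro i _
  rw [Finset.prod_range, ← Finset.prod_filter]
  apply prod_congr
  · ext j; simp
  · intro _ _; rfl

lemma vd_succ (x : ℕ → ℕ) (k : ℕ) : DD vd x (k+1) =
    DD vd x k * ∏ i ∈ range k, ((x k : ℝ) - x i) := by
  rw [vd_prod, vd_prod, prod_range_succ]
  have h1 : ∏ j ∈ range (k+1), (if k < j then ((x j : ℝ) - x k) else 1) = 1 := by
    apply prod_eq_one
    intro j hj
    rw [mem_range] at hj
    rw [if_neg (by omega)]
  rw [h1, mul_one, ← prod_mul_distrib]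
  apply prod_congr rfl
  intro i hi
  rw [mem_range] at hi
  rw [prod_range_succ, if_pos hi]

lemma vd_ne (x : Equiv.Perm ℕ) (k : ℕ) : DD vd x k ≠ 0 := by
  rw [vd_prod]
  apply prod_ne_zero_iff.2
  intro i _
  apply prod_ne_zero_iff.2
  intro j _
  split_ifs with h
  · rw [sub_ne_zero]
    intro h'
    have := x.injective (Nat.cast_injective h')
    omega
  · exact one_ne_zero

/-- signed minor -/
noncomputable def Dt (g : ℕ → ℕ → ℝ) (x : Equiv.Perm ℕ) (k : ℕ) : ℝ := DD vd x k * DD g x k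

lemma Dt_SS {x y : Equiv.Perm ℕ} {k : ℕ} (h : SS k x y) (g) : Dt g x k = Dt g y k := by
  obtain ⟨s, hs, h'⟩ := DD_perm x y k h
  unfold Dt
  rw [h' vd, h' g]
  linear_combination (DD vd y k * DD g y k) * hs

lemma Dt_eq_zero {g x k} : Dt g x k = 0 ↔ DD g x k = 0 := by
  unfold Dt
  rw [mul_eq_zero, or_iff_right (vd_ne x k)]

lemma DD_SS {x y : Equiv.Perm ℕ} {k : ℕ} (h : SS k x y) (g) : DD g x k = 0 ↔ DD g y k = 0 := by
  rw [← Dt_eq_zero, ← Dt_eq_zero, Dt_SS h]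

lemma SS_PN {n x y} (hx : PN n x) (hy : PN n y) : SS n x y := fun _ ha =>
  PN_lt (PN_inv hy) (PN_lt hx ha)

lemma SS_sw (x : Equiv.Perm ℕ) {p k : ℕ} (hk : k ≠ p + 1) : SS k (x * sw p) x := by
  intro a ha
  rw [Equiv.Perm.mul_apply, Equiv.symm_apply_apply, Equiv.swap_apply_def]
  split_ifs <;> omega

lemma DD_sum_le {g : ℕ → ℕ → ℝ} {f : ℕ → ℕ} {k : ℕ} (h : DD g f k ≠ 0) :
    ∃ σ : Equiv.Perm (Fin k), ∀ b : Fin k, g (f (σ b)) b ≠ 0 := by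
  unfold DD at h
  rw [Matrix.det_apply] at h
  obtain ⟨σ, -, hσ⟩ := exists_ne_zero_of_sum_ne_zero h
  refine ⟨σ, fun b hb => hσ ?_⟩
  rw [prod_eq_zero (mem_univ b) (by simpa using hb), smul_zero]

lemma greedy_step (n : ℕ) (g : ℕ → ℕ → ℝ) (c : ℕ → ℝ) (hg : DD g id n ≠ 0) :
    ∀ k ≤ n, ∃ (x : Equiv.Perm ℕ) (g' : ℕ → ℕ → ℝ), PN n x ∧ (∀ f m, DD g' f m = DD g f m) ∧
      (∀ i < k, g' (x i) i ≠ 0 ∧ ∀ b, i < b → g' (x i) b = 0) ∧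
      (∀ i < k, ∀ r < n, g' r i ≠ 0 → c (x i) ≤ c r) := by
  intro k
  induction k with
  | zero => intro _; exact ⟨1, g, fun _ _ => rfl, fun _ _ => rfl, by simp, by simp⟩
  | succ k ih =>
    intro hk
    obtain ⟨x, g', hx, h1, h2, h3⟩ := ih (by omega)
    classical
    let R := (range n).filter fun r => g' r k ≠ 0
    have hR : R.Nonempty := by
      by_contra hc
      rw [not_nonempty_iff_eq_empty, filter_eq_empty_iff] at hc
      apply hg
      rw [← h1]
      apply Matrix.det_eq_zero_of_column_eq_zero ⟨k, by omega⟩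
      intro a
      have := hc (mem_range.2 a.2)
      simpa using this
    obtain ⟨r0, hr0, hmin⟩ := exists_min_image R c hR
    rw [mem_filter, mem_range] at hr0
    obtain ⟨hr0n, hr0⟩ := hr0
    set e := x.symm r0 with he
    have hxe : x e = r0 := x.apply_symm_apply r0
    have hen : e < n := PN_lt (PN_inv hx) hr0n
    have hek : k ≤ e := by
      by_contra hc
      have := (h2 e (by omega)).2 k (by omega)
      rw [hxe] at this
      exact hr0 this
    let lam : ℕ → ℝ := fun b => if k < b then -(g' r0 b / g' r0 k) else 0
    have hxk : (x * Equiv.swap k e) k = r0 := by simp [hxe]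
    have hxi : ∀ i < k, (x * Equiv.swap k e) i = x i := by
      intro i hi
      rw [Equiv.Perm.mul_apply, Equiv.swap_apply_of_ne_of_ne (by omega) (by omega)]
    refine ⟨x * Equiv.swap k e, fun r b => g' r b + lam b * g' r k, ?_, ?_, ?_, ?_⟩
    · intro j hj
      rw [Equiv.Perm.mul_apply, Equiv.swap_apply_of_ne_of_ne (by omega) (by omega), hx j hj]
    · intro f m
      rw [← h1]
      apply DD_col f m k lam
      · simp [lam]
      · intro hm b hb
        simp only [lam]; rw [if_neg (by omega)]
      · intro r b; rfl
    · intro i hi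
      dsimp only
      rcases Nat.lt_succ_iff_lt_or_eq.1 hi with hi' | hi'
      · rw [hxi i hi', (h2 i hi').2 k hi']
        refine ⟨?_, ?_⟩
        · rw [mul_zero, add_zero]; exact (h2 i hi').1
        · intro b hb
          rw [(h2 i hi').2 b hb]; ring
      · subst hi'
        rw [hxk]
        refine ⟨?_, ?_⟩
        · simpa [lam] using hr0
        · intro b hb
          simp only [lam, if_pos hb]
          field_simp; ring
    · intro i hi r hr
      dsimp only
      have : lam i = 0 := by simp only [lam]; rw [if_neg (by omega)]
      rw [this, zero_mul, add_zero]
      intro hne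
      rcases Nat.lt_succ_iff_lt_or_eq.1 hi with hi' | hi'
      · rw [hxi i hi']; exact h3 i hi' r hr hne
      · subst hi'
        rw [hxk]
        exact hmin r (mem_filter.2 ⟨mem_range.2 hr, hne⟩)

theorem greedy {n : ℕ} {g : ℕ → ℕ → ℝ} (c : ℕ → ℝ) (hg : DD g id n ≠ 0) :
    ∃ x : Equiv.Perm ℕ, PN n x ∧ (∀ k ≤ n, DD g x k ≠ 0) ∧
      ∀ y, PN n y → ∀ k ≤ n, DD g y k ≠ 0 →
        ∑ a ∈ range k, c (x a) ≤ ∑ a ∈ range k, c (y a) := by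
  obtain ⟨x, g', hx, h1, h2, h3⟩ := greedy_step n g c hg n le_rfl
  refine ⟨x, hx, ?_, ?_⟩
  · intro k hk
    rw [← h1]
    unfold DD
    rw [Matrix.det_of_isLowerTriangular]
    · apply prod_ne_zero_iff.2
      intro i _
      exact (h2 i (by omega)).1
    · intro i j hij
      exact (h2 i (by omega)).2 j hij
  · intro y hy k hk hne
    rw [← h1] at hne
    obtain ⟨σ, hσ⟩ := DD_sum_le hne
    rw [sum_range, sum_range, ← Equiv.sum_comp σ (fun a : Fin k => c (y a))]
    apply sum_le_sum
    intro b _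
    have hb := (σ b).2
    exact h3 b (by omega) _ (PN_lt hy (by omega)) (hσ b)

lemma ext_flag {n : ℕ} {g : ℕ → ℕ → ℝ} (hg : DD g id n ≠ 0) {x : Equiv.Perm ℕ} (hx : PN n x)
    {k : ℕ} (hk : k ≤ n) (h : DD g x k ≠ 0) :
    ∃ y, PN n y ∧ (∀ j ≤ n, DD g y j ≠ 0) ∧ SS k y x := by
  classical
  obtain ⟨y, hy, h1, h2⟩ := greedy (fun r => if x.symm r < k then (0:ℝ) else 1) hg
  refine ⟨y, hy, h1, ?_⟩
  have := h2 x hx k hk h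
  have h0 : ∑ a ∈ range k, (if x.symm (x a) < k then (0:ℝ) else 1) = 0 := by
    apply sum_eq_zero
    intro a ha
    rw [mem_range] at ha
    simp [ha]
  rw [h0] at this
  have hnn : ∀ a ∈ range k, (0:ℝ) ≤ (if x.symm (y a) < k then (0:ℝ) else 1) := by
    intro a _; split_ifs <;> norm_num
  have hz := (sum_eq_zero_iff_of_nonneg hnn).1 (le_antisymm this (sum_nonneg hnn))
  intro a ha
  have := hz a (mem_range.2 ha)
  by_contra hc
  rw [if_neg hc] at this
  norm_num at this

/-- Schur complement -/
lemma schur (g : ℕ → ℕ → ℝ) (f : ℕ → ℕ) (k : ℕ) (h : DD g f k ≠ 0) :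
    ∃ S : ℕ → (ℕ → ℝ) → ℝ, ∀ (f' : ℕ → ℕ) (g' : ℕ → ℕ → ℝ), (∀ a < k, f' a = f a) →
      (∀ r, ∀ b < k, g' r b = g r b) →
      DD g' f' (k+1) = DD g f k * S (f' k) (fun r => g' r k) ∧
      DD g' f' (k+2) = DD g f k *
        (S (f' k) (fun r => g' r k) * S (f' (k+1)) (fun r => g' r (k+1)) -
         S (f' k) (fun r => g' r (k+1)) * S (f' (k+1)) (fun r => g' r k)) := by
  classical
  let A : Matrix (Fin k) (Fin k) ℝ := Matrix.of fun a b : Fin k => g (f a) b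
  have hA : IsUnit A.det := isUnit_iff_ne_zero.2 h
  let _ : Invertible A := Matrix.invertibleOfIsUnitDet A hA
  let S : ℕ → (ℕ → ℝ) → ℝ := fun r cv => cv r - ∑ j : Fin k, (∑ i : Fin k, g r i * (⅟A) i j) * cv (f j)
  have key : ∀ (l : ℕ) (f' : ℕ → ℕ) (g' : ℕ → ℕ → ℝ), (∀ a < k, f' a = f a) →
      (∀ r, ∀ b < k, g' r b = g r b) → DD g' f' (k+l) = DD g f k *
      Matrix.det (Matrix.of fun a b : Fin l => S (f' (k+a)) (fun r => g' r (k+b))) := by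
    intro l f' g' hf hg
    unfold DD
    rw [← Matrix.det_submatrix_equiv_self (finSumFinEquiv (m := k) (n := l))]
    have : (Matrix.of fun a b : Fin (k+l) => g' (f' a) b).submatrix finSumFinEquiv finSumFinEquiv =
        Matrix.fromBlocks A (Matrix.of fun (a : Fin k) (b : Fin l) => g' (f a) (k+b))
          (Matrix.of fun (a : Fin l) (b : Fin k) => g (f' (k+a)) b)
          (Matrix.of fun (a : Fin l) (b : Fin l) => g' (f' (k+a)) (k+b)) := by
      ext a b
      rcases a with a | a <;> rcases b with b | b <;> simp [A, hf, hg]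
    rw [this, Matrix.det_fromBlocks₁₁]
    congr 2
  refine ⟨S, fun f' g' hf hg => ⟨?_, ?_⟩⟩
  · rw [key 1 f' g' hf hg, Matrix.det_fin_one]; simp
  · rw [key 2 f' g' hf hg, Matrix.det_fin_two]; simp

end part5

section part6
open Finset

def gB (g : ℕ → ℕ → ℝ) (p : ℕ) : ℕ → ℕ → ℝ :=
  fun r b => if b = p then g r (p+1) else if b = p + 1 then - g r p else g r b

lemma DD_gB (g : ℕ → ℕ → ℝ) (p : ℕ) (x : ℕ → ℕ) {j : ℕ} (hj : j ≠ p + 1) :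
    DD (gB g p) x j = DD g x j := by
  by_cases h : j ≤ p
  · apply DD_congr
    intro a _ b hb
    unfold gB
    rw [if_neg (by omega), if_neg (by omega)]
  · let g1 : ℕ → ℕ → ℝ := fun r b => g r b + (if b = p then 1 else 0) * g r (p+1)
    let g2 : ℕ → ℕ → ℝ := fun r b => g1 r b + (if b = p + 1 then -1 else 0) * g1 r p
    have e1 : DD g1 x j = DD g x j := by
      apply DD_col x j (p+1) (fun b => if b = p then 1 else 0)
      · simp
      · intro; omega
      · intro r b; rfl
    have e2 : DD g2 x j = DD g1 x j := by
      apply DD_col x j p (fun b => if b = p + 1 then -1 else 0)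
      · simp
      · intro; omega
      · intro r b; rfl
    rw [← e1, ← e2]
    apply DD_col x j (p+1) (fun b => if b = p then 1 else 0)
    · simp
    · intro; omega
    · intro r b
      by_cases hb : b = p
      · subst hb; simp [gB, g1, g2]
      · by_cases hb' : b = p + 1
        · subst hb'; simp [gB, g1, g2]
        · simp [gB, g1, g2, hb, hb']

lemma DD_lin (g g' : ℕ → ℕ → ℝ) (p : ℕ) (x : ℕ → ℕ) (a e : ℝ)
    (h1 : ∀ r, ∀ b < p, g' r b = g r b) (h2 : ∀ r, g' r p = a * g r p + e * g r (p+1)) :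
    DD g' x (p+1) = a * DD g x (p+1) + e * DD (gB g p) x (p+1) := by
  obtain ⟨C, hC⟩ := DD_last g x p
  rw [hC g' h1, hC g (fun _ _ _ => rfl), hC (gB g p), mul_sum, mul_sum, ← sum_add_distrib]
  · apply sum_congr rfl
    intro i _
    rw [h2]; simp [gB]; ring
  · intro r b hb
    unfold gB
    rw [if_neg (by omega), if_neg (by omega)]

lemma sw_lt (x : Equiv.Perm ℕ) {p a : ℕ} (ha : a < p) : (x * sw p) a = x a := by
  rw [Equiv.Perm.mul_apply, Equiv.swap_apply_of_ne_of_ne (by omega) (by omega)]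

lemma three_term (g : ℕ → ℕ → ℝ) (p : ℕ) (x : Equiv.Perm ℕ) (h : DD g x p ≠ 0) :
    Dt g x p * Dt g x (p+2) = ((x (p+1) : ℝ) - x p) *
      (Dt g x (p+1) * Dt (gB g p) (x * sw p) (p+1) -
        Dt g (x * sw p) (p+1) * Dt (gB g p) x (p+1)) := by
  obtain ⟨S, hS⟩ := schur g x p h
  have hB : ∀ r, ∀ b < p, gB g p r b = g r b := by
    intro r b hb
    unfold gB
    rw [if_neg (by omega), if_neg (by omega)]
  have hBp : (fun r => gB g p r p) = fun r => g r (p+1) := by funext r; simp [gB]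
  have hsw : ∀ a < p, (x * sw p) a = x a := fun a ha => sw_lt x ha
  have a1 := hS x g (fun _ _ => rfl) (fun _ _ _ => rfl)
  have a2 := (hS ⇑(x * sw p : Equiv.Perm ℕ) g hsw (fun _ _ _ => rfl)).1
  have a3 := (hS x (gB g p) (fun _ _ => rfl) hB).1
  have a4 := (hS ⇑(x * sw p : Equiv.Perm ℕ) (gB g p) hsw hB).1
  rw [hBp] at a3 a4
  rw [sw_app_l] at a2 a4
  have w1 := vd_succ x (p+1)
  have w2 := vd_succ ⇑(x * sw p : Equiv.Perm ℕ) p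
  have w0 : DD vd ⇑(x * sw p : Equiv.Perm ℕ) p = DD vd x p := DD_congr fun a ha b _ => by rw [hsw a ha]
  rw [prod_range_succ] at w1
  rw [sw_app_l, w0] at w2
  have w3 : ∏ i ∈ range p, ((x (p+1) : ℝ) - (x * sw p) i) =
      ∏ i ∈ range p, ((x (p+1) : ℝ) - x i) := by
    apply prod_congr rfl
    intro i hi
    rw [hsw i (mem_range.1 hi)]
  rw [w3] at w2
  unfold Dt
  rw [w1, w2, a1.1, a1.2, a2, a3, a4]
  ring

def Good (n : ℕ) (v w : Equiv.Perm ℕ) (g : ℕ → ℕ → ℝ) : Prop :=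
  (∀ r j, r < v j → g r j = 0) ∧ (∀ x, PN n x → ∀ k ≤ n, 0 ≤ Dt g x k) ∧
  (∀ x, PN n x → ((∀ k ≤ n, DD g x k ≠ 0) ↔ bl v x ∧ bl x w))

lemma rk_of_P0 {v y : Equiv.Perm ℕ} {g : ℕ → ℕ → ℝ} {k : ℕ} (h0 : ∀ r j, r < v j → g r j = 0)
    (h : DD g y k ≠ 0) (m : ℕ) : rk v k m ≤ rk y k m := by
  obtain ⟨σ, hσ⟩ := DD_sum_le h
  unfold rk
  rw [sum_range, sum_range, ← Equiv.sum_comp σ (fun a : Fin k => if m ≤ y a then 1 else 0)]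
  apply sum_le_sum
  intro b _
  have : v b ≤ y (σ b) := by
    by_contra hc
    exact hσ b (h0 _ _ (by omega))
  split_ifs <;> omega

lemma good_id {n v w g} (hg : Good n v w g) (hv : PN n v) (hvw : bl v w) : DD g id n ≠ 0 := by
  have h := ((hg.2.2 v hv).2 ⟨bl_refl v, hvw⟩) n le_rfl
  have h1 : PN n 1 := fun _ _ => rfl
  have := (DD_SS (SS_PN hv h1) g).not.1 h
  exact this

lemma good_base (n : ℕ) : Good n 1 1 (fun r j => if r = j then 1 else 0) := by
  set g : ℕ → ℕ → ℝ := fun r j => if r = j then 1 else 0 with hg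
  have h1 : ∀ k, DD g (1 : Equiv.Perm ℕ) k = 1 := by
    intro k
    unfold DD
    rw [← Matrix.det_one (n := Fin k)]
    congr 1
    ext a b
    simp [hg, Matrix.one_apply, Fin.ext_iff]
  have hpos : ∀ k, 0 < DD vd (1 : Equiv.Perm ℕ) k := by
    intro k
    rw [vd_prod]
    apply prod_pos; intro i _
    apply prod_pos; intro j _
    split_ifs with h
    · have : (i : ℝ) < j := by exact_mod_cast h
      simpa using this
    · norm_num
  have hss : ∀ (x : Equiv.Perm ℕ) k, DD g x k ≠ 0 → SS k x 1 := by
    intro x k h a ha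
    obtain ⟨σ, hσ⟩ := DD_sum_le h
    have h2 := hσ (σ.symm ⟨a, ha⟩)
    simp only [Equiv.apply_symm_apply, hg] at h2
    have h3 : x a = (σ.symm ⟨a, ha⟩ : Fin k) := by
      by_contra hc
      simp [hc] at h2
    change x a < k
    rw [h3]; exact (σ.symm ⟨a, ha⟩).2
  refine ⟨?_, ?_, ?_⟩
  · intro r j h
    have : r ≠ j := by rintro rfl; exact lt_irrefl _ h
    simp [hg, this]
  · intro x _ k _
    by_cases h : DD g x k = 0
    · rw [Dt_eq_zero.2 h]
    · rw [Dt_SS (hss x k h)]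
      unfold Dt
      rw [h1, mul_one]; exact (hpos k).le
  · intro x hx
    constructor
    · intro h
      have hb : bl x 1 := by
        intro k m
        by_cases hk : k ≤ n
        · have h3 := hss x k (h k hk)
          unfold rk
          rw [sum_range, sum_range]
          have hinj : Function.Injective (fun a : Fin k => (⟨x a, h3 a a.2⟩ : Fin k)) := by
            intro a b hab
            have := congrArg Fin.val hab
            exact Fin.ext (x.injective this)
          let σ := Equiv.ofBijective _ (Finite.injective_iff_bijective.1 hinj)
          rw [← Equiv.sum_comp σ (fun a : Fin k => if m ≤ (1 : Equiv.Perm ℕ) a then 1 else 0)]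
          apply le_of_eq
          apply sum_congr rfl
          intro a _
          rfl
        · have hn := hss x n (h n le_rfl)
          have : x = 1 := by
            have hle : ∀ j, x j ≤ j := by
              intro j
              by_cases hj : j < n
              · have := hss x (j+1) (h (j+1) hj) j (by omega)
                change x j < j + 1 at this
                omega
              · rw [hx j (by omega)]
            apply eq_one_of_asc hx
            intro p _
            have hall : ∀ j, x j = j := by
              intro j
              induction j using Nat.strong_induction_on with
              | _ j ih =>
                rcases (hle j).lt_or_eq with hj | hj
                · have := x.injective (ih _ hj)
                  omega
                · exact hj
            rw [hall, hall]; omega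
          rw [this]
      rw [bl_one hb]
      exact ⟨bl_refl _, bl_refl _⟩
    · rintro ⟨-, h⟩ k _
      rw [bl_one h, h1]; exact one_ne_zero

section step
variable {n p : ℕ} {v w : Equiv.Perm ℕ} {g : ℕ → ℕ → ℝ}

lemma Dt_sw (g : ℕ → ℕ → ℝ) (x : Equiv.Perm ℕ) {p k : ℕ} (hk : k ≠ p + 1) :
    Dt g (x * sw p) k = Dt g x k := Dt_SS (SS_sw x hk) g

lemma DD_sw (g : ℕ → ℕ → ℝ) (x : Equiv.Perm ℕ) {p k : ℕ} (hk : k ≠ p + 1) :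
    DD g ⇑(x * sw p : Equiv.Perm ℕ) k = 0 ↔ DD g x k = 0 := DD_SS (SS_sw x hk) g

/-- all minors except level p+1 are non zero and the p+1 minor of g or gB is nonzero -/
lemma mem_of_ne (hg : Good n v w g) (hp : p + 1 < n) {x : Equiv.Perm ℕ} (hx : PN n x)
    (h : ∀ k ≤ n, k ≠ p + 1 → DD g x k ≠ 0) (h' : DD g x (p+1) ≠ 0 ∨ DD (gB g p) x (p+1) ≠ 0) :
    (bl v x ∧ bl x w) ∨ (bl v (x * sw p) ∧ bl (x * sw p) w) := by
  by_cases ha : DD g x (p+1) = 0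
  · right
    rw [← hg.2.2 _ (PN_sw hx hp)]
    intro k hk
    by_cases hkp : k = p + 1
    · subst hkp
      intro hz
      have := three_term g p x (h p (by omega) (by omega))
      rw [Dt_eq_zero.2 ha, Dt_eq_zero.2 hz] at this
      simp only [zero_mul, sub_zero, mul_zero, mul_eq_zero, Dt_eq_zero] at this
      exact this.elim (h p (by omega) (by omega)) (h (p+2) (by omega) (by omega))
    · rw [Ne, DD_sw g x hkp]; exact h k hk hkp
  · left
    rw [← hg.2.2 _ hx]
    intro k hk
    by_cases hkp : k = p + 1
    · subst hkp; exact ha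
    · exact h k hk hkp

lemma ne_of_mem (hg : Good n v w g) (hp : p + 1 < n) {x : Equiv.Perm ℕ} (hx : PN n x)
    (h : (bl v x ∧ bl x w) ∨ (bl v (x * sw p) ∧ bl (x * sw p) w)) :
    (∀ k ≤ n, k ≠ p + 1 → DD g x k ≠ 0) ∧ (DD g x (p+1) ≠ 0 ∨ DD (gB g p) x (p+1) ≠ 0) := by
  rcases h with h | h
  · rw [← hg.2.2 _ hx] at h
    exact ⟨fun k hk _ => h k hk, Or.inl (h (p+1) hp.le)⟩
  · rw [← hg.2.2 _ (PN_sw hx hp)] at h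
    have h1 : ∀ k ≤ n, k ≠ p + 1 → DD g x k ≠ 0 := fun k hk hkp => by
      rw [Ne, ← DD_sw g x hkp]; exact h k hk
    refine ⟨h1, ?_⟩
    by_contra hc
    push Not at hc
    have := three_term g p x (h1 p (by omega) (by omega))
    rw [Dt_eq_zero.2 hc.1, Dt_eq_zero.2 hc.2] at this
    simp only [zero_mul, sub_zero, mul_zero, mul_eq_zero, Dt_eq_zero] at this
    exact this.elim (h1 p (by omega) (by omega)) (h1 (p+2) (by omega) (by omega))

lemma Dt_pos (hg : Good n v w g) {x : Equiv.Perm ℕ} (hx : PN n x) {k : ℕ} (hk : k ≤ n)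
    (h : DD g x k ≠ 0) : 0 < Dt g x k :=
  lt_of_le_of_ne (hg.2.1 x hx k hk) (Ne.symm (Dt_eq_zero.not.2 h))

lemma lemA0 (hg : Good n v w g) (hp : p + 1 < n) (hv : PN n v) (hvw : bl v w)
    (hva : v p < v (p+1)) {x : Equiv.Perm ℕ} (hx : PN n x)
    (h : Dt g x (p+1) = 0) : 0 ≤ Dt (gB g p) x (p+1) := by
  by_cases hd : DD (gB g p) x (p+1) = 0
  · rw [Dt_eq_zero.2 hd]
  have hid : DD (gB g p) id n ≠ 0 := by
    rw [DD_gB g p id (by omega)]; exact good_id hg hv hvw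
  obtain ⟨y, hy, hy1, hy2⟩ := ext_flag hid hx hp.le hd
  rw [← Dt_SS hy2] at h ⊢
  have hne : ∀ k ≤ n, k ≠ p + 1 → DD g y k ≠ 0 := fun k hk hkp => by
    rw [← DD_gB g p y hkp]; exact hy1 k hk
  have hmem := mem_of_ne hg hp hy hne (Or.inr (hy1 (p+1) hp.le))
  have hnot : ¬ (bl v y ∧ bl y w) := by
    rw [← hg.2.2 y hy]
    intro hc
    exact hc (p+1) hp.le (Dt_eq_zero.1 h)
  have hys := hmem.resolve_left hnot
  have hdesc : y (p+1) < y p := by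
    by_contra hc
    have hasc : y p < y (p+1) := lt_of_le_of_ne (not_lt.1 hc) (app_ne y p)
    exact hnot ⟨bl_down hys.1 hva, bl_trans (bl_sw hasc) hys.2⟩
  have h3 := three_term g p y (hne p (by omega) (by omega))
  rw [h] at h3
  have q1 := Dt_pos hg hy (by omega : p ≤ n) (hne p (by omega) (by omega))
  have q2 := Dt_pos hg hy (by omega : p + 2 ≤ n) (hne (p+2) (by omega) (by omega))
  have q3 := hg.2.1 _ (PN_sw hy hp) (p+1) hp.le
  have q4 : (y (p+1) : ℝ) < y p := by exact_mod_cast hdesc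
  by_contra hneg
  push Not at hneg
  have e1 : 0 < Dt g y p * Dt g y (p+2) := mul_pos q1 q2
  have e2 : Dt g (y * sw p) (p+1) * Dt (gB g p) y (p+1) ≤ 0 :=
    mul_nonpos_of_nonneg_of_nonpos q3 hneg.le
  nlinarith [mul_nonneg (sub_nonneg.2 q4.le) (neg_nonneg.2 e2)]

lemma exists_eps {ι : Type*} [Finite ι] (a b : ι → ℝ) :
    ∃ ε : ℝ, 0 < ε ∧ ∀ i, 0 < a i → 0 < a i + ε * b i := by
  have h1 : ∀ i, ∀ᶠ ε in nhdsWithin (0:ℝ) (Set.Ioi 0), 0 < a i → 0 < a i + ε * b i := by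
    intro i
    by_cases hi : 0 < a i
    · have : Filter.Tendsto (fun ε : ℝ => a i + ε * b i) (nhds 0) (nhds (a i + 0 * b i)) := by
        apply Continuous.tendsto (f := fun ε : ℝ => a i + ε * b i); fun_prop
      have h2 := this.eventually (lt_mem_nhds (show 0 < a i + 0 * b i by simpa using hi))
      exact (h2.filter_mono nhdsWithin_le_nhds).mono fun _ h _ => h
    · exact Filter.Eventually.of_forall fun _ h => absurd h hi
  have h2 := Filter.eventually_all.2 h1
  obtain ⟨ε, h3, h4⟩ := (h2.and self_mem_nhdsWithin).exists
  exact ⟨ε, h4, h3⟩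

lemma caseA (hg : Good n v w g) (hp : p + 1 < n) (hv : PN n v) (hvw : bl v w)
    (hva : v p < v (p+1)) (hwa : w p < w (p+1)) : ∃ g', Good n v (w * sw p) g' := by
  obtain ⟨ε, hε, h⟩ := exists_eps (fun u : Equiv.Perm (Fin n) => Dt g (phi n u) (p+1))
    (fun u => Dt (gB g p) (phi n u) (p+1))
  have hE : ∀ x, PN n x → 0 < Dt g x (p+1) → 0 < Dt g x (p+1) + ε * Dt (gB g p) x (p+1) := by
    intro x hx
    obtain ⟨u, rfl⟩ := phi_surj hx
    exact h u
  let g' : ℕ → ℕ → ℝ := fun r b => g r b + (if b = p then ε else 0) * g r (p+1)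
  have e1 : ∀ (x : ℕ → ℕ) k, k ≠ p + 1 → DD g' x k = DD g x k := by
    intro x k hk
    apply DD_col x k (p+1) (fun b => if b = p then ε else 0)
    · simp
    · intro h1 b hb
      rw [if_neg (by omega)]
    · intro r b; rfl
  have e2 : ∀ x : ℕ → ℕ, DD g' x (p+1) = DD g x (p+1) + ε * DD (gB g p) x (p+1) := by
    intro x
    rw [DD_lin g g' p x 1 ε, one_mul]
    · intro r b hb; simp only [g']; rw [if_neg (by omega)]; ring
    · intro r; simp [g']
  have e3 : ∀ x, Dt g' x (p+1) = Dt g x (p+1) + ε * Dt (gB g p) x (p+1) := by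
    intro x; unfold Dt; rw [e2]; ring
  refine ⟨g', ?_, ?_, ?_⟩
  · intro r j hr
    simp only [g']
    rw [hg.1 r j hr]
    split_ifs with hj
    · subst hj; rw [hg.1 r (j+1) (by omega)]; ring
    · ring
  · intro x hx k hk
    by_cases hkp : k = p + 1
    · subst hkp
      rw [e3]
      rcases (hg.2.1 x hx (p+1) hk).lt_or_eq with h1 | h1
      · exact (hE x hx h1).le
      · have := lemA0 hg hp hv hvw hva hx h1.symm
        rw [← h1]
        have := mul_nonneg hε.le this
        linarith
    · unfold Dt; rw [e1 x k hkp]; exact hg.2.1 x hx k hk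
  · intro x hx
    rw [interval_A hva hwa]
    constructor
    · intro hk
      apply mem_of_ne hg hp hx
      · intro k hk1 hk2; rw [← e1 x k hk2]; exact hk k hk1
      · by_contra hc
        push Not at hc
        apply hk (p+1) hp.le
        rw [e2, hc.1, hc.2]; ring
    · intro hm
      obtain ⟨h1, h2⟩ := ne_of_mem hg hp hx hm
      intro k hk
      by_cases hkp : k = p + 1
      · subst hkp
        by_cases ha : DD g x (p+1) = 0
        · rw [e2, ha, zero_add]
          exact mul_ne_zero hε.ne' (h2.resolve_left (fun h => h ha))
        · rw [Ne, ← Dt_eq_zero, e3]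
          exact (hE x hx (Dt_pos hg hx hk ha)).ne'
      · rw [e1 x k hkp]; exact h1 k hk hkp

lemma PN_gB_P0 (hg : ∀ r j, r < v j → g r j = 0) (r j : ℕ) (h : r < (v * sw p) j) :
    gB g p r j = 0 := by
  unfold gB
  split_ifs with h1 h2
  · subst h1; rw [sw_app_l] at h; exact hg _ _ h
  · subst h2; rw [sw_app_r] at h; rw [hg _ _ h, neg_zero]
  · rw [Equiv.Perm.mul_apply, Equiv.swap_apply_of_ne_of_ne h1 h2] at h
    exact hg _ _ h

lemma bl_of_P0 (hg : ∀ r j, r < v j → g r j = 0) {x : Equiv.Perm ℕ} (h : bl v x)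
    (hx : DD (gB g p) x (p+1) ≠ 0) : bl (v * sw p) x := by
  intro k m
  by_cases hk : k = p + 1
  · subst hk
    exact rk_of_P0 (PN_gB_P0 hg) hx m
  · rw [rk_sw_ne _ _ _ _ hk]; exact h k m

lemma arrow_tau (hg : Good n v w g) (hp : p + 1 < n) (hv : PN n v)
    (hva : v p < v (p+1)) (τ : ℝ) (hτ : 0 ≤ τ)
    (hnn : ∀ x, PN n x → 0 ≤ Dt (gB g p) x (p+1) + τ * Dt g x (p+1))
    {x : Equiv.Perm ℕ} (hx : PN n x) (h1 : bl (v * sw p) x) (h2 : bl x (w * sw p)) :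
    Dt (gB g p) x (p+1) + τ * Dt g x (p+1) ≠ 0 := by
  intro h0
  have hvd : (v * sw p) (p+1) < (v * sw p) p := by rw [sw_app_l, sw_app_r]; exact hva
  obtain ⟨z, z1, z2, z3, z4, z5⟩ := lemC hp (PN_sw hv hp) hvd _ x rfl hx h1
  rw [← Dt_SS z4, ← Dt_SS z4] at h0
  have b1 := bl_dd z2 hvd
  rw [mul_sw_sw] at b1
  have b2 := bl_dd (bl_trans z3 h2) z5
  rw [mul_sw_sw] at b2
  have hK := (hg.2.2 _ (PN_sw z1 hp)).2 ⟨b1, b2⟩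
  have hne := (ne_of_mem hg hp z1 (Or.inr ⟨b1, b2⟩)).1
  have h3 := three_term g p z (hne p (by omega) (by omega))
  have q1 := Dt_pos hg z1 (by omega : p ≤ n) (hne p (by omega) (by omega))
  have q2 := Dt_pos hg z1 (by omega : p + 2 ≤ n) (hne (p+2) (by omega) (by omega))
  have q3 := hg.2.1 _ z1 (p+1) hp.le
  have q4 : (z (p+1) : ℝ) < z p := by exact_mod_cast z5
  have q5 := hnn _ (PN_sw z1 hp)
  have e1 : 0 < Dt g z p * Dt g z (p+2) := mul_pos q1 q2
  have e2 : Dt (gB g p) z (p+1) = - τ * Dt g z (p+1) := by linarith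
  rw [h3, e2] at e1
  have e3 : Dt g z (p+1) * Dt (gB g p) (z * sw p) (p+1) -
      Dt g (z * sw p) (p+1) * (-τ * Dt g z (p+1)) = Dt g z (p+1) *
      (Dt (gB g p) (z * sw p) (p+1) + τ * Dt g (z * sw p) (p+1)) := by ring
  rw [e3] at e1
  have e4 := mul_nonneg q3 q5
  nlinarith [mul_nonneg (sub_nonneg.2 q4.le) e4]

lemma caseB (hg : Good n v w g) (hp : p + 1 < n) (hv : PN n v) (hvw : bl v w)
    (hva : v p < v (p+1)) (hwa : w p < w (p+1)) :
    Good n (v * sw p) (w * sw p) (gB g p) := by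
  have hpos : ∀ x, PN n x → 0 ≤ Dt (gB g p) x (p+1) := by
    by_contra hcon
    push Not at hcon
    obtain ⟨x1, hx1, hneg⟩ := hcon
    have ha1 : 0 < Dt g x1 (p+1) := by
      rcases (hg.2.1 x1 hx1 (p+1) hp.le).lt_or_eq with h | h
      · exact h
      · have := lemA0 hg hp hv hvw hva hx1 h.symm
        linarith
    obtain ⟨u1, rfl⟩ := phi_surj hx1
    classical
    let T := univ.filter fun u : Equiv.Perm (Fin n) => 0 < Dt g (phi n u) (p+1)
    have hu1 : u1 ∈ T := mem_filter.2 ⟨mem_univ _, ha1⟩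
    obtain ⟨u0, hu0, hmax⟩ := exists_max_image T
      (fun u => - Dt (gB g p) (phi n u) (p+1) / Dt g (phi n u) (p+1)) ⟨u1, hu1⟩
    have ha0 : 0 < Dt g (phi n u0) (p+1) := (mem_filter.1 hu0).2
    set τ := - Dt (gB g p) (phi n u0) (p+1) / Dt g (phi n u0) (p+1) with hτ
    have hτpos : 0 < τ := by
      refine lt_of_lt_of_le ?_ (hmax u1 hu1)
      exact div_pos (by linarith) ha1
    have hz : Dt (gB g p) (phi n u0) (p+1) + τ * Dt g (phi n u0) (p+1) = 0 := by
      rw [hτ, div_mul_cancel₀ _ ha0.ne']; ring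
    have hnn : ∀ x, PN n x → 0 ≤ Dt (gB g p) x (p+1) + τ * Dt g x (p+1) := by
      intro x hx
      rcases (hg.2.1 x hx (p+1) hp.le).lt_or_eq with h | h
      · obtain ⟨u, rfl⟩ := phi_surj hx
        have := hmax u (mem_filter.2 ⟨mem_univ _, h⟩)
        rw [div_le_iff₀ h] at this
        linarith
      · have := lemA0 hg hp hv hvw hva hx h.symm
        rw [← h]; linarith
    obtain ⟨y, hy, hy1, hy2⟩ := ext_flag (good_id hg hv hvw) (phi_PN u0) hp.le
      (Dt_eq_zero.not.1 ha0.ne')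
    rw [← Dt_SS hy2, ← Dt_SS hy2] at hz
    have hyK := (hg.2.2 y hy).1 hy1
    have hd : DD (gB g p) y (p+1) ≠ 0 := by
      rw [Ne, ← Dt_eq_zero]
      intro h
      rw [h, Dt_SS hy2, zero_add] at hz
      exact (mul_pos hτpos ha0).ne' hz
    exact arrow_tau hg hp hv hva τ hτpos.le hnn hy (bl_of_P0 hg.1 hyK.1 hd)
      (bl_trans hyK.2 (bl_sw hwa)) hz
  refine ⟨fun r j h => PN_gB_P0 hg.1 r j h, ?_, ?_⟩
  · intro x hx k hk
    by_cases hkp : k = p + 1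
    · subst hkp; exact hpos x hx
    · unfold Dt; rw [DD_gB g p x hkp]; exact hg.2.1 x hx k hk
  · intro x hx
    constructor
    · intro h
      have := mem_of_ne hg hp hx (fun k hk hkp => by rw [← DD_gB g p x hkp]; exact h k hk)
        (Or.inr (h (p+1) hp.le))
      rw [← interval_A hva hwa] at this
      exact ⟨bl_of_P0 hg.1 this.1 (h (p+1) hp.le), this.2⟩
    · rintro ⟨h1, h2⟩
      have h3 : bl v x := bl_trans (bl_sw hva) h1
      have hm := (interval_A hva hwa).1 ⟨h3, h2⟩
      have hne := (ne_of_mem hg hp hx hm).1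
      intro k hk
      by_cases hkp : k = p + 1
      · subst hkp
        have := arrow_tau hg hp hv hva 0 le_rfl (by
          intro x hx; rw [zero_mul, add_zero]; exact hpos x hx) hx h1 h2
        rw [zero_mul, add_zero] at this
        exact Dt_eq_zero.not.1 this
      · rw [DD_gB g p x hkp]; exact hne k hk hkp

end step

theorem exists_good {n : ℕ} : ∀ (N : ℕ) (v w : Equiv.Perm ℕ), PN n v → PN n w → ilen n w = N →
    bl v w → ∃ g, Good n v w g := by
  intro N
  induction N with
  | zero =>
    intro v w hv hw h hb
    have h1 : w = 1 := by
      by_contra h1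
      obtain ⟨p, hp, hd⟩ := exists_desc hw h1
      have := ilen_sw' hp w hd
      omega
    subst h1
    obtain rfl := bl_one hb
    exact ⟨_, good_base n⟩
  | succ N ih =>
    intro v w hv hw h hb
    have h1 : w ≠ 1 := by rintro rfl; rw [ilen_one] at h; omega
    obtain ⟨p, hp, hd⟩ := exists_desc hw h1
    have hN := ilen_sw' hp w hd
    have hwa : (w * sw p) p < (w * sw p) (p+1) := by rw [sw_app_l, sw_app_r]; exact hd
    rcases lt_or_gt_of_ne (app_ne v p) with h4 | h4
    · have hb' : bl v (w * sw p) := bl_down (p := p) (by rw [mul_sw_sw]; exact hb) h4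
      obtain ⟨g, hg⟩ := ih v (w * sw p) hv (PN_sw hw hp) (by omega) hb'
      have := caseA hg hp hv hb' h4 hwa
      rwa [mul_sw_sw] at this
    · obtain ⟨g, hg⟩ := ih (v * sw p) (w * sw p) (PN_sw hv hp) (PN_sw hw hp) (by omega)
        (bl_dd hb h4)
      have hva : (v * sw p) p < (v * sw p) (p+1) := by rw [sw_app_l, sw_app_r]; exact h4
      have := caseB hg hp (PN_sw hv hp) (bl_dd hb h4) hva hwa
      rw [mul_sw_sw, mul_sw_sw] at this
      exact ⟨_, this⟩

/-- simultaneous minimiser over a Bruhat interval -/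
theorem exists_min_flag {n : ℕ} {v w : Equiv.Perm ℕ} (hv : PN n v) (hw : PN n w) (h : bl v w)
    (c : ℕ → ℝ) : ∃ x, PN n x ∧ bl v x ∧ bl x w ∧ ∀ y, PN n y → bl v y → bl y w → ∀ k ≤ n,
      ∑ a ∈ range k, c (x a) ≤ ∑ a ∈ range k, c (y a) := by
  obtain ⟨g, hg⟩ := exists_good _ v w hv hw rfl h
  obtain ⟨x, hx, h1, h2⟩ := greedy c (good_id hg hv h)
  have hK := (hg.2.2 x hx).1 h1
  refine ⟨x, hx, hK.1, hK.2, ?_⟩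
  intro y hy y1 y2 k hk
  exact h2 y hy k hk ((hg.2.2 y hy).2 ⟨y1, y2⟩ k hk)

end part6

section part7
open Finset

section prism
variable {E U : Type*} [NormedAddCommGroup E] [NormedSpace ℝ E] [Fintype U] [Nonempty U]

def FF (a : U → E) (f : E →L[ℝ] ℝ) : Set U := {u | ∀ u', f (a u') ≤ f (a u)}

def bb (a b : U → E) : U × Bool → E := fun x => if x.2 then b x.1 else a x.1

def Pr (a : U → E) (G : Set (U × Bool)) : Prop :=
  ∃ f : E →L[ℝ] ℝ, G = {x | x.1 ∈ FF a f ∧ x.2 = true} ∨ G = {x | x.1 ∈ FF a f ∧ x.2 = false} ∨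
    G = {x | x.1 ∈ FF a f}

lemma FF_ne (a : U → E) (f : E →L[ℝ] ℝ) : ∃ x, x ∈ FF a f := by
  obtain ⟨x, hx⟩ := Finite.exists_max (fun u => f (a u))
  exact ⟨x, hx⟩

lemma FF_shift (a : U → E) (f L : E →L[ℝ] ℝ) (κ τ : ℝ) (hL : ∀ u, L (a u) = κ) :
    FF a (f + τ • L) = FF a f := by
  ext u
  simp [FF, hL]

lemma arg_pos {a b : U → E} {f : E →L[ℝ] ℝ} {x : U} (hx : x ∈ FF b f)
    (h : ∀ u, f (a u) < f (b x)) :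
    {y | ∀ u, f (bb a b u) ≤ f (bb a b y)} = {y : U × Bool | y.1 ∈ FF b f ∧ y.2 = true} := by
  ext ⟨y, ε⟩
  cases ε
  · simp only [Set.mem_ofPred_eq]
    constructor
    · intro h1
      have h3 : f (b x) ≤ f (a y) := by simpa [bb] using h1 (x, true)
      exact absurd (h y) (not_lt.2 h3)
    · simp
  · constructor
    · intro h1
      exact ⟨fun u => by simpa [bb] using h1 (u, true), rfl⟩
    · rintro ⟨h1, -⟩ ⟨u, ε⟩
      have h2 : f (b x) ≤ f (b y) := h1 x
      have h3 := h u
      have h4 : f (b u) ≤ f (b y) := h1 u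
      cases ε <;> simp [bb] <;> linarith

lemma arg_neg {a b : U → E} {f : E →L[ℝ] ℝ} {x : U} (hx : x ∈ FF a f)
    (h : ∀ u, f (b u) < f (a x)) :
    {y | ∀ u, f (bb a b u) ≤ f (bb a b y)} = {y : U × Bool | y.1 ∈ FF a f ∧ y.2 = false} := by
  ext ⟨y, ε⟩
  cases ε
  · constructor
    · intro h1
      exact ⟨fun u => by simpa [bb] using h1 (u, false), rfl⟩
    · rintro ⟨h1, -⟩ ⟨u, ε⟩
      have h2 : f (a x) ≤ f (a y) := h1 x
      have h3 := h u
      have h4 : f (a u) ≤ f (a y) := h1 u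
      cases ε <;> simp [bb] <;> linarith
  · simp only [Set.mem_ofPred_eq]
    constructor
    · intro h1
      have h3 : f (a x) ≤ f (b y) := by simpa [bb] using h1 (x, false)
      exact absurd (h y) (not_lt.2 h3)
    · simp

lemma arg_zero {a b : U → E} {f : E →L[ℝ] ℝ} {x : U} (hx : x ∈ FF a f)
    (hab : FF a f = FF b f) (h : f (a x) = f (b x)) :
    {y | ∀ u, f (bb a b u) ≤ f (bb a b y)} = {y : U × Bool | y.1 ∈ FF a f} := by
  have hx' : x ∈ FF b f := hab ▸ hx
  ext ⟨y, ε⟩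
  constructor
  · intro h1
    cases ε
    · exact fun u => by simpa [bb] using h1 (u, false)
    · change y ∈ FF a f
      rw [hab]
      exact fun u => by simpa [bb] using h1 (u, true)
  · intro h1 ⟨u, ε'⟩
    change y ∈ FF a f at h1
    have h1' : y ∈ FF b f := hab ▸ h1
    have e1 := h1 x
    have e2 := h1' x
    have e3 := hx u
    have e4 := hx' u
    cases ε <;> cases ε' <;> simp [bb] <;> linarith

theorem left_abs (a b : U → E) (L : E →L[ℝ] ℝ) (κ : ℝ) (hL : ∀ u, L (a u) = κ)
    (hL' : ∀ u, L (b u) = κ + 1) (hF : ∀ f, FF a f = FF b f) (G : Set (U × Bool)) :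
    IsArg (bb a b) G ↔ Pr a G := by
  constructor
  · rintro ⟨f, rfl⟩
    obtain ⟨x, hx⟩ := FF_ne a f
    have hx' : x ∈ FF b f := hF f ▸ hx
    refine ⟨f, ?_⟩
    rcases lt_trichotomy (f (a x)) (f (b x)) with h | h | h
    · left
      rw [hF, arg_pos hx']
      exact fun u => lt_of_le_of_lt (hx u) h
    · right; right
      exact arg_zero hx (hF f) h
    · right; left
      rw [arg_neg hx]
      exact fun u => lt_of_le_of_lt (hx' u) h
  · rintro ⟨f, hG⟩
    obtain ⟨x, hx⟩ := FF_ne a f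
    have key : ∀ δ : ℝ, ∃ f' : E →L[ℝ] ℝ, FF a f' = FF a f ∧ FF b f' = FF a f ∧
        f' (b x) = f' (a x) + δ := by
      intro δ
      refine ⟨f + (f (a x) - f (b x) + δ) • L, FF_shift a f L κ _ hL, ?_, ?_⟩
      · rw [hF f]; exact FF_shift b f L _ _ hL'
      · simp [hL, hL']; ring
    rcases hG with rfl | rfl | rfl
    · obtain ⟨f', h1, h2, h3⟩ := key 1
      refine ⟨f', ?_⟩
      rw [← h2] at hx ⊢
      rw [arg_pos hx]
      rw [h2, ← h1] at hx
      intro u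
      have := hx u
      linarith
    · obtain ⟨f', h1, h2, h3⟩ := key (-1)
      refine ⟨f', ?_⟩
      rw [← h1] at hx ⊢
      rw [arg_neg hx]
      rw [h1, ← h2] at hx
      intro u
      have := hx u
      linarith
    · obtain ⟨f', h1, h2, h3⟩ := key 0
      refine ⟨f', ?_⟩
      rw [← h1] at hx ⊢
      rw [arg_zero hx (hF f') (by linarith)]

theorem right_abs (a b : U → E) (L : E →L[ℝ] ℝ) (κ : ℝ) (hL : ∀ u, L (a u) = κ)
    (σ : E →L[ℝ] E) (hσ : ∀ x, σ (σ x) = x) (hb : ∀ u, b u = σ (a u)) (d : U → ℝ)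
    (hd : ∀ u, 0 < d u) (e : E) (hbe : ∀ u, b u = a u + d u • e) (hσe : σ e = -e) (hLe : L e = 1)
    (G : Set (U × Bool)) :
    IsArg (bb a b) G ↔ Pr a G := by
  have hFσ : ∀ f : E →L[ℝ] ℝ, FF b f = FF a (f.comp σ) := by
    intro f; ext u; simp [FF, hb]
  have hfb : ∀ (f : E →L[ℝ] ℝ) u, f (b u) = f (a u) + d u * f e := by
    intro f u; rw [hbe]; simp
  constructor
  · rintro ⟨f, rfl⟩
    rcases lt_trichotomy (f e) 0 with h | h | h
    · obtain ⟨x, hx⟩ := FF_ne a f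
      refine ⟨f, Or.inr (Or.inl ?_)⟩
      rw [arg_neg hx]
      intro u
      rw [hfb]
      have := hx u
      nlinarith [hd u]
    · obtain ⟨x, hx⟩ := FF_ne a f
      refine ⟨f, Or.inr (Or.inr ?_)⟩
      rw [arg_zero hx ?_ (by rw [hfb, h]; ring)]
      ext u; simp [FF, hfb, h]
    · obtain ⟨x, hx⟩ := FF_ne b f
      refine ⟨f.comp σ, Or.inl ?_⟩
      rw [← hFσ, arg_pos hx]
      intro u
      have := hx u
      rw [hfb] at this
      nlinarith [hd u]
  · rintro ⟨f, rfl | rfl | rfl⟩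
    · let f' := (f + (- f e - 1) • L).comp σ
      have h1 : FF b f' = FF a f := by
        rw [hFσ, ← FF_shift a f L κ (- f e - 1) hL]
        congr 1
        ext x
        simp [f', hσ]
      have h2 : f' e = 1 := by simp [f', hσe, hLe]
      obtain ⟨x, hx⟩ := FF_ne b f'
      refine ⟨f', ?_⟩
      rw [← h1, arg_pos hx]
      intro u
      have := hx u
      rw [hfb] at this
      nlinarith [hd u]
    · have h1 := FF_shift a f L κ (- f e - 1) hL
      have h2 : (f + (- f e - 1) • L) e = -1 := by simp [hLe]; ring
      obtain ⟨x, hx⟩ := FF_ne a (f + (- f e - 1) • L)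
      refine ⟨f + (- f e - 1) • L, ?_⟩
      rw [← h1, arg_neg hx]
      intro u
      have := hx u
      rw [hfb, h2]
      nlinarith [hd u]
    · have h1 := FF_shift a f L κ (- f e) hL
      have h2 : (f + (- f e) • L) e = 0 := by simp [hLe]
      obtain ⟨x, hx⟩ := FF_ne a (f + (- f e) • L)
      refine ⟨f + (- f e) • L, ?_⟩
      rw [← h1, arg_zero hx ?_ (by rw [hfb, h2]; ring)]
      ext u; simp only [FF, Set.mem_ofPred_eq, hfb, h2, mul_zero, add_zero]

theorem prism_abs (a : U → E) (G : Set (U × Bool)) :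
    IsArg (bb (fun u => (a u, (0:ℝ))) (fun u => (a u, (1:ℝ)))) G ↔ Pr a G := by
  rw [left_abs _ _ (ContinuousLinearMap.snd ℝ E ℝ) 0]
  · constructor
    · rintro ⟨f, h⟩
      exact ⟨f.comp (ContinuousLinearMap.inl ℝ E ℝ), h⟩
    · rintro ⟨f, h⟩
      exact ⟨f.comp (ContinuousLinearMap.fst ℝ E ℝ), h⟩
  · intro u; simp
  · intro u; simp
  · intro f
    ext u
    have : ∀ u, f (a u, 1) = f (a u, 0) + f (0, 1) := by
      intro u; rw [← map_add]; simp
    simp [FF, this]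

lemma range_bb (a b : U → E) : Set.range (bb a b) = Set.range a ∪ Set.range b := by
  ext x
  constructor
  · rintro ⟨⟨u, ε⟩, rfl⟩
    cases ε
    · left; exact ⟨u, by simp [bb]⟩
    · right; exact ⟨u, by simp [bb]⟩
  · rintro (⟨u, rfl⟩ | ⟨u, rfl⟩)
    · exact ⟨(u, false), by simp [bb]⟩
    · exact ⟨(u, true), by simp [bb]⟩

lemma hull_prism (a : U → E) :
    convexHull ℝ (Set.range (bb (fun u => (a u, (0:ℝ))) (fun u => (a u, (1:ℝ))))) =
      convexHull ℝ (Set.range a) ×ˢ Set.Icc (0:ℝ) 1 := by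
  rw [← segment_eq_Icc zero_le_one, ← convexHull_pair, ← convexHull_prod, range_bb]
  congr 1
  ext ⟨x, t⟩
  simp only [Set.mem_union, Set.mem_range, Prod.mk.injEq, Set.mem_prod, Set.mem_insert_iff,
    Set.mem_singleton_iff]
  constructor
  · rintro (⟨u, h1, h2⟩ | ⟨u, h1, h2⟩)
    · exact ⟨⟨u, h1⟩, Or.inl h2.symm⟩
    · exact ⟨⟨u, h1⟩, Or.inr h2.symm⟩
  · rintro ⟨⟨u, h1⟩, h2 | h2⟩
    · exact Or.inl ⟨u, h1, h2.symm⟩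
    · exact Or.inr ⟨u, h1, h2.symm⟩

end prism

end part7

section part8
open Finset

lemma bl_inv_iff {x y : Equiv.Perm ℕ} : bl x⁻¹ y⁻¹ ↔ bl x y :=
  ⟨fun h => by simpa using bl_inv h, bl_inv⟩

lemma pres_of_bl {x w : Equiv.Perm ℕ} {r : ℕ} (h : bl x w) (hw : ∀ j < r, w j < r) :
    ∀ j < r, x j < r := by
  rw [← rk_eq_zero] at hw ⊢
  have := h r r
  omega

lemma pres_iff {x : Equiv.Perm ℕ} {r : ℕ} (h : ∀ j < r, x j < r) (j : ℕ) : x j < r ↔ j < r := by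
  constructor
  · intro hj
    have := Equiv.Perm.perm_symm_on_of_perm_on_finset (s := range r) (f := x)
      (fun y hy => mem_range.2 (h y (mem_range.1 hy))) (mem_range.2 hj)
    simpa using this
  · exact h j

lemma pres_inv {x : Equiv.Perm ℕ} {r : ℕ} (h : ∀ j < r, x j < r) : ∀ j < r, x⁻¹ j < r := by
  intro j hj
  rw [← pres_iff h]; simpa using hj

lemma asc_of_pres {x : Equiv.Perm ℕ} {p : ℕ} (h : ∀ j < p + 1, x j < p + 1) : x p < x (p+1) := by
  have h1 := h p (by omega)
  have h2 := (pres_iff h (p+1)).not.2 (by omega)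
  omega

lemma interval_L {v w x : Equiv.Perm ℕ} {p : ℕ} (hv : v⁻¹ p < v⁻¹ (p+1))
    (hw : w⁻¹ p < w⁻¹ (p+1)) :
    (bl v x ∧ bl x (sw p * w)) ↔
      (bl v x ∧ bl x w) ∨ (bl v (sw p * x) ∧ bl (sw p * x) w) := by
  have := interval_A (x := x⁻¹) hv hw
  have e : ∀ y : Equiv.Perm ℕ, y⁻¹ * sw p = (sw p * y)⁻¹ := by intro y; simp [sw]
  rw [e, e] at this
  simpa only [bl_inv_iff] using this

section final
variable {n p : ℕ} {v w : Equiv.Perm (Fin n)}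

abbrev UU (n : ℕ) (v w : Equiv.Perm (Fin n)) : Type :=
  {u : Equiv.Perm (Fin n) // bruhatLE n v u ∧ bruhatLE n u w}

lemma range_UU : Set.range (fun u : UU n v w => permPoint n u.1) =
    {x | ∃ u : Equiv.Perm (Fin n), bruhatLE n v u ∧ bruhatLE n u w ∧ x = permPoint n u} := by
  ext x
  constructor
  · rintro ⟨u, rfl⟩; exact ⟨u.1, u.2.1, u.2.2, rfl⟩
  · rintro ⟨u, h1, h2, rfl⟩; exact ⟨⟨u, h1, h2⟩, rfl⟩

noncomputable def LL (n r : ℕ) : (Fin n → ℝ) →L[ℝ] ℝ :=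
  ∑ i ∈ univ.filter (fun i : Fin n => (i : ℕ) < r), ContinuousLinearMap.proj i

lemma LL_app (r : ℕ) (x : Fin n → ℝ) :
    LL n r x = ∑ i ∈ univ.filter (fun i : Fin n => (i : ℕ) < r), x i := by
  simp [LL]

lemma LL_perm {r : ℕ} {u : Equiv.Perm (Fin n)} (hu : ∀ j < r, phi n u j < r)
    (t : Fin n → ℝ) : LL n r (fun i => t (u i)) = LL n r t := by
  rw [LL_app, LL_app]
  apply sum_equiv u
  · intro i
    simp only [mem_filter, mem_univ, true_and]
    rw [← phi_fin, pres_iff hu]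
  · intro i _; rfl

lemma simpleT_eq (hp : p + 1 < n) : simpleT n (p+1) =
    Equiv.swap (⟨p, by omega⟩ : Fin n) ⟨p+1, hp⟩ := by
  unfold simpleT
  rw [dif_pos ⟨by omega, hp⟩]
  rfl

lemma phi_s (hp : p + 1 < n) : phi n (simpleT n (p+1)) = sw p := by
  rw [phi_simple]; unfold TT
  rw [if_pos ⟨by omega, hp⟩]; rfl

lemma simpleT_val (hp : p + 1 < n) (j : Fin n) : ((simpleT n (p+1) j : ℕ) : ℝ) =
    (j : ℕ) + (if (j : ℕ) = p then 1 else 0) - (if (j : ℕ) = p + 1 then 1 else 0) := by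
  rw [simpleT_eq hp, Equiv.swap_apply_def]
  by_cases h1 : (j : ℕ) = p
  · rw [if_pos (Fin.ext h1)]; simp [h1]
  · rw [if_neg (fun h => h1 (congrArg Fin.val h))]
    by_cases h2 : (j : ℕ) = p + 1
    · rw [if_pos (Fin.ext h2)]; simp [h2]
    · rw [if_neg (fun h => h2 (congrArg Fin.val h))]; simp [h1, h2]

lemma BIP_eq_hull (v w : Equiv.Perm (Fin n)) (b : UU n v w → Fin n → ℝ) (w' : Equiv.Perm (Fin n))
    (σ : Equiv.Perm (Fin n) → Equiv.Perm (Fin n)) (hσ : ∀ u, σ (σ u) = u)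
    (hb : ∀ u, b u = permPoint n (σ u.1))
    (h : ∀ x, (bruhatLE n v x ∧ bruhatLE n x w') ↔ (bruhatLE n v x ∧ bruhatLE n x w) ∨
      (bruhatLE n v (σ x) ∧ bruhatLE n (σ x) w)) :
    BIP n v w' = convexHull ℝ (Set.range (bb (fun u : UU n v w => permPoint n u.1) b)) := by
  unfold BIP
  congr 1
  ext x
  constructor
  · rintro ⟨u, h1, h2, rfl⟩
    rcases (h u).1 ⟨h1, h2⟩ with h3 | h3
    · exact ⟨(⟨u, h3⟩, false), by simp [bb]⟩
    · exact ⟨(⟨σ u, h3⟩, true), by simp [bb, hb, hσ]⟩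
  · rintro ⟨⟨u, ε⟩, rfl⟩
    cases ε
    · have := (h u.1).2 (Or.inl u.2)
      exact ⟨u.1, this.1, this.2, by simp [bb]⟩
    · have := (h (σ u.1)).2 (Or.inr (by rw [hσ]; exact u.2))
      exact ⟨σ u.1, this.1, this.2, by simp [bb, hb]⟩

theorem combine (v w w' : Equiv.Perm (Fin n)) (hvw : bruhatLE n v w) (b : UU n v w → Fin n → ℝ)
    (h1 : BIP n v w' = convexHull ℝ (Set.range (bb (fun u : UU n v w => permPoint n u.1) b)))
    (h2 : ∀ G, IsArg (bb (fun u : UU n v w => permPoint n u.1) b) G ↔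
      Pr (fun u : UU n v w => permPoint n u.1) G) :
    CombEquiv (BIP n v w') (BIP n v w ×ˢ Set.Icc (0 : ℝ) 1) := by
  classical
  haveI : Fintype (UU n v w) := Fintype.ofFinite _
  haveI : Nonempty (UU n v w) := ⟨⟨w, hvw, (bruhat_iff n w w).2 (bl_refl _)⟩⟩
  have h3 : BIP n v w = convexHull ℝ (Set.range (fun u : UU n v w => permPoint n u.1)) := by
    rw [range_UU]; rfl
  rw [h1, h3, ← hull_prism]
  apply combEquiv_of_arg
  intro G
  rw [h2, prism_abs]

variable (hp : p + 1 < n) (hw : ∀ j < p + 1, phi n w j < p + 1)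

lemma UU_pres (hw : ∀ j < p + 1, phi n w j < p + 1) (u : UU n v w) :
    ∀ j < p + 1, phi n u.1 j < p + 1 := pres_of_bl ((bruhat_iff n _ _).1 u.2.2) hw

theorem right_case (hp : p + 1 < n) (hw : ∀ j < p + 1, phi n w j < p + 1)
    (hvw : bruhatLE n v w) :
    CombEquiv (BIP n v (w * simpleT n (p+1))) (BIP n v w ×ˢ Set.Icc (0 : ℝ) 1) := by
  classical
  have hv : ∀ j < p + 1, phi n v j < p + 1 := pres_of_bl ((bruhat_iff n _ _).1 hvw) hw
  have hss : simpleT n (p+1) * simpleT n (p+1) = 1 := by rw [simpleT_eq hp]; simp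
  apply combine v w _ hvw (fun u => permPoint n (u.1 * simpleT n (p+1)))
  · apply BIP_eq_hull v w _ _ (fun u => u * simpleT n (p+1))
    · intro u; rw [mul_assoc, hss, mul_one]
    · intro u; rfl
    · intro x
      simp only [bruhat_iff, map_mul, phi_s hp]
      exact interval_A (asc_of_pres hv) (asc_of_pres hw)
  · intro G
    haveI : Fintype (UU n v w) := Fintype.ofFinite _
    haveI : Nonempty (UU n v w) := ⟨⟨w, hvw, (bruhat_iff n w w).2 (bl_refl _)⟩⟩
    let i0 : Fin n := ⟨p, by omega⟩
    let i1 : Fin n := ⟨p+1, hp⟩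
    have h01 : i0 ≠ i1 := by intro h; have := congrArg Fin.val h; simp [i0, i1] at this
    let s := simpleT n (p+1)
    have hs : s = Equiv.swap i0 i1 := simpleT_eq hp
    let σ : (Fin n → ℝ) →L[ℝ] (Fin n → ℝ) :=
      ContinuousLinearMap.pi fun i => ContinuousLinearMap.proj (s i)
    have hσ : ∀ x i, σ x i = x (s i) := fun x i => rfl
    have hss' : ∀ i, s (s i) = i := by intro i; rw [hs]; simp
    apply right_abs _ _ (LL n (p+1)) (LL n (p+1) fun i => ((i : ℕ) : ℝ) + 1) ?_ σ ?_ ?_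
      (fun u => ((u.1 i1 : ℕ) : ℝ) - (u.1 i0 : ℕ)) ?_ (Pi.single i0 1 - Pi.single i1 1) ?_ ?_ ?_
    · intro u
      exact LL_perm (UU_pres hw u) (fun i => ((i : ℕ) : ℝ) + 1)
    · intro x; ext i; rw [hσ, hσ, hss']
    · intro u; ext i; rw [hσ]; rfl
    · intro u
      have := asc_of_pres (UU_pres hw u)
      rw [phi_lt u.1 hp, phi_lt u.1 (by omega : p < n)] at this
      rw [sub_pos]
      exact_mod_cast this
    · intro u
      ext i
      simp only [Pi.add_apply, Pi.smul_apply, Pi.sub_apply, smul_eq_mul, permPoint,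
        Equiv.Perm.mul_apply]
      change (((u.1 (s i) : Fin n) : ℕ) : ℝ) + 1 = _
      rw [hs]
      by_cases h0 : i = i0
      · subst h0; rw [Equiv.swap_apply_left, Pi.single_eq_same, Pi.single_eq_of_ne h01]; ring
      · by_cases h1 : i = i1
        · subst h1; rw [Equiv.swap_apply_right, Pi.single_eq_same, Pi.single_eq_of_ne h0]; ring
        · rw [Equiv.swap_apply_of_ne_of_ne h0 h1, Pi.single_eq_of_ne h0, Pi.single_eq_of_ne h1]
          ring
    · ext i
      rw [hσ]
      simp only [Pi.sub_apply, Pi.neg_apply]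
      rw [hs]
      by_cases h0 : i = i0
      · subst h0; rw [Equiv.swap_apply_left, Pi.single_eq_same, Pi.single_eq_of_ne h01,
          Pi.single_eq_same, Pi.single_eq_of_ne h01.symm]; ring
      · by_cases h1 : i = i1
        · subst h1; rw [Equiv.swap_apply_right, Pi.single_eq_same, Pi.single_eq_of_ne h01,
            Pi.single_eq_same, Pi.single_eq_of_ne h0]; ring
        · rw [Equiv.swap_apply_of_ne_of_ne h0 h1, Pi.single_eq_of_ne h0, Pi.single_eq_of_ne h1]
          ring
    · rw [LL_app]
      simp only [Pi.sub_apply, Pi.single_apply]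
      rw [sum_sub_distrib, sum_ite_eq', sum_ite_eq', if_pos, if_neg]
      · ring
      · simp [i1]
      · simp [i0]

lemma abel (c : ℕ → ℝ) (n : ℕ) : ∑ j ∈ range n, c j * ((j : ℝ) + 1) =
    n * (∑ j ∈ range n, c j) - ∑ k ∈ range n, ∑ j ∈ range k, c j := by
  induction n with
  | zero => simp
  | succ n ih => rw [sum_range_succ, ih, sum_range_succ c, sum_range_succ (fun k => ∑ j ∈ range k, c j)]; push_cast; ring

theorem left_case (hp : p + 1 < n) (hw : ∀ j < p + 1, phi n w j < p + 1)
    (hvw : bruhatLE n v w) :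
    CombEquiv (BIP n v (simpleT n (p+1) * w)) (BIP n v w ×ˢ Set.Icc (0 : ℝ) 1) := by
  classical
  have hv : ∀ j < p + 1, phi n v j < p + 1 := pres_of_bl ((bruhat_iff n _ _).1 hvw) hw
  have hss : simpleT n (p+1) * simpleT n (p+1) = 1 := by rw [simpleT_eq hp]; simp
  apply combine v w _ hvw (fun u => permPoint n (simpleT n (p+1) * u.1))
  · apply BIP_eq_hull v w _ _ (fun u => simpleT n (p+1) * u)
    · intro u; rw [← mul_assoc, hss, one_mul]
    · intro u; rfl
    · intro x
      simp only [bruhat_iff, map_mul, phi_s hp]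
      exact interval_L (asc_of_pres (pres_inv hv)) (asc_of_pres (pres_inv hw))
  · intro G
    haveI : Fintype (UU n v w) := Fintype.ofFinite _
    haveI : Nonempty (UU n v w) := ⟨⟨w, hvw, (bruhat_iff n w w).2 (bl_refl _)⟩⟩
    apply left_abs _ _ (LL n (p+1)) (LL n (p+1) fun i => ((i : ℕ) : ℝ) + 1)
    · intro u
      exact LL_perm (UU_pres hw u) (fun i => ((i : ℕ) : ℝ) + 1)
    · intro u
      refine (LL_perm (UU_pres hw u) (fun i => ((simpleT n (p+1) i : ℕ) : ℝ) + 1)).trans ?_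
      rw [LL_app, LL_app]
      have : ∀ i ∈ univ.filter (fun i : Fin n => (i : ℕ) < p + 1),
          ((simpleT n (p+1) i : ℕ) : ℝ) + 1 = (((i : ℕ) : ℝ) + 1) +
            if i = (⟨p, by omega⟩ : Fin n) then 1 else 0 := by
        intro i hi
        have hi' := (mem_filter.1 hi).2
        rw [simpleT_val hp, if_neg (by omega : ¬ (i : ℕ) = p + 1)]
        simp only [Fin.ext_iff]
        ring
      rw [sum_congr rfl this, sum_add_distrib, sum_ite_eq', if_pos (by simp)]
    · intro f
      let c : ℕ → ℝ := fun j => if h : j < n then f (Pi.single ⟨j, h⟩ 1) else 0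
      have hf : ∀ x : Fin n → ℝ, f x = ∑ i : Fin n, c i * x i := by
        intro x
        conv_lhs => rw [← Finset.univ_sum_single x, map_sum]
        apply sum_congr rfl
        intro i _
        have : (Pi.single i (x i) : Fin n → ℝ) = x i • Pi.single i 1 := by
          rw [← Pi.single_smul]; simp
        rw [this, map_smul, smul_eq_mul, mul_comm]
        simp [c]
      have hf2 : ∀ (u : Equiv.Perm (Fin n)) (t : ℕ → ℝ), f (fun i => t (u i)) =
          ∑ j ∈ range n, c ((phi n u)⁻¹ j) * t j := by
        intro u t
        rw [hf, sum_range, ← Equiv.sum_comp u (fun j : Fin n => c ((phi n u)⁻¹ j) * t j)]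
        apply sum_congr rfl
        intro i _
        have : (phi n u)⁻¹ ((u i : Fin n) : ℕ) = i := by rw [← phi_fin]; simp
        simp only [this]
      let S : UU n v w → ℕ → ℝ := fun u k => ∑ j ∈ range k, c ((phi n u.1)⁻¹ j)
      have hA : ∀ u : UU n v w, f (permPoint n u.1) = n * S u n - ∑ k ∈ range n, S u k := by
        intro u
        rw [← abel]
        exact hf2 u.1 (fun j => (j : ℝ) + 1)
      have hB : ∀ u : UU n v w, f (permPoint n (simpleT n (p+1) * u.1)) =
          f (permPoint n u.1) + 2 * S u (p+1) - (S u p + S u (p+2)) := by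
        intro u
        have e1 : permPoint n (simpleT n (p+1) * u.1) = fun i => (fun j : ℕ => ((j : ℝ) + 1) +
            ((if j = p then 1 else 0) - (if j = p + 1 then 1 else 0))) (u.1 i : ℕ) := by
          ext i
          simp only [permPoint, Equiv.Perm.mul_apply]
          rw [simpleT_val hp]; ring
        rw [e1, hf2 u.1 (fun j : ℕ => ((j : ℝ) + 1) +
            ((if j = p then 1 else 0) - (if j = p + 1 then 1 else 0)))]
        have e2 := hf2 u.1 (fun j => (j : ℝ) + 1)
        change f (permPoint n u.1) = _ at e2
        rw [e2]
        simp only [mul_add, mul_sub, sum_add_distrib, sum_sub_distrib, mul_ite, mul_one, mul_zero]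
        rw [sum_ite_eq', sum_ite_eq', if_pos (mem_range.2 (by omega)), if_pos (mem_range.2 hp)]
        simp only [S]
        rw [sum_range_succ _ (p+1), sum_range_succ _ p]
        ring
      have hc : ∀ (x : Equiv.Perm ℕ) (r : ℕ), (∀ j < r, x j < r) →
          ∑ j ∈ range r, c (x j) = ∑ j ∈ range r, c j := by
        intro x r hx
        apply sum_equiv x
        · intro i; rw [mem_range, mem_range, pres_iff hx]
        · intro i _; rfl
      have hSn : ∀ u, S u n = ∑ j ∈ range n, c j := fun u =>
        hc _ _ (fun j hj => PN_lt (PN_inv (phi_PN u.1)) hj)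
      have hSr : ∀ u, S u (p+1) = ∑ j ∈ range (p+1), c j := fun u =>
        hc _ _ (pres_inv (UU_pres hw u))
      obtain ⟨x, hx, x1, x2, hmin⟩ := exists_min_flag (PN_inv (phi_PN v)) (PN_inv (phi_PN w))
        (bl_inv ((bruhat_iff n v w).1 hvw)) c
      obtain ⟨u0, hu0⟩ := phi_surj (PN_inv hx)
      have hu0' : x = (phi n u0)⁻¹ := by rw [hu0, inv_inv]
      rw [hu0', bl_inv_iff, ← bruhat_iff] at x1 x2
      let U0 : UU n v w := ⟨u0, x1, x2⟩
      have hm : ∀ u, ∀ k ≤ n, S U0 k ≤ S u k := by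
        intro u k hk
        have := hmin _ (PN_inv (phi_PN u.1)) (bl_inv ((bruhat_iff n _ _).1 u.2.1))
          (bl_inv ((bruhat_iff n _ _).1 u.2.2)) k hk
        rw [hu0'] at this
        exact this
      have hs : ∀ u, ∑ k ∈ range n, S U0 k ≤ ∑ k ∈ range n, S u k := fun u =>
        sum_le_sum fun k hk => hm u k (mem_range.1 hk).le
      ext u
      simp only [FF, Set.mem_ofPred_eq, hB, hA, hSn, hSr]
      constructor
      · intro h u'
        have h1 := h U0
        have h2 : ∑ k ∈ range n, S U0 k = ∑ k ∈ range n, S u k := le_antisymm (hs u) (by linarith)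
        have h3 := (sum_eq_sum_iff_of_le fun k hk => hm u k (mem_range.1 hk).le).1 h2
        have h4 : S U0 p = S u p := h3 p (mem_range.2 (by omega))
        have h5 : S U0 (p+2) = S u (p+2) := by
          rcases (by omega : p + 2 < n ∨ p + 2 = n) with h6 | h6
          · exact h3 _ (mem_range.2 h6)
          · rw [h6, hSn, hSn]
        have := hm u' p (by omega)
        have := hm u' (p+2) (by omega)
        have := h u'
        linarith
      · intro h u'
        have h1 := h U0
        have := hm u p (by omega)
        have := hm u (p+2) (by omega)
        have := hs u'
        linarith

end final


end part8

/-- For `v ≤ w` with `s_r ∉ supp(w)`, both `Q_{v, s_r w}` and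
`Q_{v, w s_r}` are combinatorially equivalent to the prism `Q_{v,w} × [0,1]`. -/
theorem stmt16 (n r : ℕ) (hr : 1 ≤ r) (hrn : r < n) (v w : Equiv.Perm (Fin n))
    (hvw : bruhatLE n v w) (hw : r ∉ permSupp n w) :
    CombEquiv (BIP n v (simpleT n r * w)) (BIP n v w ×ˢ Set.Icc (0 : ℝ) 1) ∧
    CombEquiv (BIP n v (w * simpleT n r)) (BIP n v w ×ˢ Set.Icc (0 : ℝ) 1) := by
  obtain ⟨p, rfl⟩ : ∃ p, r = p + 1 := ⟨r - 1, by omega⟩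
  have h := supp_pres hw
  exact ⟨left_case hrn h hvw, right_case hrn h hvw⟩
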